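/- Let 0 < ε < 1 and C > 0 be constants. There exist constants r₀, K and m₀, depending only on ε and C, such that the following holds for all m ≥ m₀. Let G be a finite abelian group and let A = {a₁, …, a_n} be a symmetric multiset of elements of G with ρ_m(A) ≥ m^{−C}. Then for every n' with εn ≤ n' ≤ n there exists a symmetric proper coset-progression H + Q in G of rank r ≤ r₀ such that a_i ∈ H + Q for at least n − n' indices i ∈ {1, …, n} (counted with multiplicity), and |H + Q| ≤ max{1, K · ρ_m(A)^{−1} / (m·n'/n)^{r/2}}. -/

import Mathlib

open Pointwise

/-- A generalized arithmetic progression (GAP) of rank `r` in an additive abelian group,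
given by its generators and dimensions. -/
structure GAPData (G : Type*) [AddCommGroup G] (r : ℕ) where
  g₀ : G
  g : Fin r → G
  N : Fin r → ℤ
  N' : Fin r → ℤ
  hle : ∀ i, N i ≤ N' i

namespace GAPData

variable {G : Type*} [AddCommGroup G] {r : ℕ}

/-- The set of elements of the GAP. -/
def toSet (P : GAPData G r) : Set G :=
  {x | ∃ m : Fin r → ℤ, (∀ i, P.N i ≤ m i ∧ m i ≤ P.N' i) ∧ x = P.g₀ + ∑ i, m i • P.g i}

/-- A GAP is proper if every element has a unique representation. -/
def IsProper (P : GAPData G r) : Prop :=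
  ∀ m m' : Fin r → ℤ, (∀ i, P.N i ≤ m i ∧ m i ≤ P.N' i) →
    (∀ i, P.N i ≤ m' i ∧ m' i ≤ P.N' i) →
    P.g₀ + ∑ i, m i • P.g i = P.g₀ + ∑ i, m' i • P.g i → m = m'

/-- A GAP is symmetric if `g₀ = 0` and `N i = -N' i` for all `i`. -/
def IsSymmetric (P : GAPData G r) : Prop :=
  P.g₀ = 0 ∧ ∀ i, P.N i = -P.N' i

end GAPData

/-- `H + P` is a proper coset-progression: `H` is a finite subgroup, `P` is a proper GAP and
`|H + P| = |H| * |P|`. -/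
def IsProperCosetProg {G : Type*} [AddCommGroup G] {r : ℕ}
    (H : AddSubgroup G) (P : GAPData G r) : Prop :=
  (H : Set G).Finite ∧ P.IsProper ∧
    ((H : Set G) + P.toSet).ncard = (H : Set G).ncard * P.toSet.ncard

/-- `ρ_m(A)`: the maximum discrepancy from uniform of the `m`-step random walk whose iid
steps are uniform on the multiset `A = {a₁, …, a_n}` in the finite abelian group `G`. -/
noncomputable def rhoWalkG {G : Type*} [AddCommGroup G] [Fintype G] (n m : ℕ)
    (A : Fin n → G) : ℝ :=
  ⨆ a : G, |({f : Fin m → Fin n | ∑ j, A (f j) = a}.ncard : ℝ) / (n : ℝ) ^ m -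
    1 / (Fintype.card G : ℝ)|

section Reduction

variable {E : Type*} [AddCommGroup E] [Module ℝ E]

/-- The quotient of a seminorm-like function by the line spanned by `b`. -/
noncomputable def quotSeminorm (p : E → ℝ) (b v : E) : ℝ := ⨅ t : ℝ, p (v - t • b)

section QuotSeminorm

variable {p : E → ℝ} (hadd : ∀ u v, p (u + v) ≤ p u + p v)
  (hsmul : ∀ (t : ℝ) v, p (t • v) = |t| * p v)

theorem seminorm_zero_of_smul (hsmul : ∀ (t : ℝ) v, p (t • v) = |t| * p v) : p 0 = 0 := by
  simpa using hsmul 0 0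

theorem seminorm_neg_of_smul (hsmul : ∀ (t : ℝ) v, p (t • v) = |t| * p v) (v : E) :
    p (-v) = p v := by
  simpa using hsmul (-1) v

theorem seminorm_zsmul_of_smul (hsmul : ∀ (t : ℝ) v, p (t • v) = |t| * p v) (n : ℤ) (v : E) :
    p (n • v) = |(n : ℝ)| * p v := by
  rw [← hsmul, Int.cast_smul_eq_zsmul]

include hadd hsmul in
theorem seminorm_nonneg_of_smul (v : E) : 0 ≤ p v := by
  have h := hadd v (-v)
  rw [seminorm_neg_of_smul hsmul, add_neg_cancel, seminorm_zero_of_smul hsmul] at h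
  linarith

include hadd hsmul in
theorem seminorm_sum_le_of_smul {ι : Type*} (s : Finset ι) (f : ι → E) :
    p (∑ i ∈ s, f i) ≤ ∑ i ∈ s, p (f i) := by
  classical
  induction s using Finset.induction_on with
  | empty => simp [seminorm_zero_of_smul hsmul]
  | insert a s ha ih =>
    rw [Finset.sum_insert ha, Finset.sum_insert ha]
    linarith [hadd (f a) (∑ i ∈ s, f i)]

include hadd hsmul in
theorem quotSeminorm_le (b v : E) (t : ℝ) : quotSeminorm p b v ≤ p (v - t • b) :=
  ciInf_le ⟨0, by rintro _ ⟨t, rfl⟩; exact seminorm_nonneg_of_smul hadd hsmul _⟩ t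

include hadd hsmul in
theorem quotSeminorm_le_self (b v : E) : quotSeminorm p b v ≤ p v := by
  simpa using quotSeminorm_le hadd hsmul b v 0

theorem exists_lt_of_quotSeminorm_lt {b v : E} {c : ℝ} (h : quotSeminorm p b v < c) :
    ∃ t : ℝ, p (v - t • b) < c :=
  exists_lt_of_ciInf_lt h

include hadd hsmul in
theorem exists_int_of_quotSeminorm_lt {b v : E} {c : ℝ} (h : quotSeminorm p b v < c) :
    ∃ n : ℤ, p (v - n • b) < c + p b / 2 := by
  obtain ⟨t, ht⟩ := exists_lt_of_quotSeminorm_lt h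
  refine ⟨round t, ?_⟩
  have h1 : v - round t • b = (v - t • b) + (t - round t) • b := by
    rw [sub_smul, Int.cast_smul_eq_zsmul]; abel
  have h2 := hadd (v - t • b) ((t - round t) • b)
  rw [hsmul] at h2
  have h3 := mul_le_mul_of_nonneg_right (abs_sub_round t) (seminorm_nonneg_of_smul hadd hsmul b)
  rw [h1]
  linarith

include hadd hsmul in
theorem quotSeminorm_add (b u v : E) :
    quotSeminorm p b (u + v) ≤ quotSeminorm p b u + quotSeminorm p b v := by
  refine le_of_forall_pos_lt_add fun e he => ?_
  obtain ⟨s, hs⟩ := exists_lt_of_quotSeminorm_lt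
    (show quotSeminorm p b u < quotSeminorm p b u + e / 2 by linarith)
  obtain ⟨t, ht⟩ := exists_lt_of_quotSeminorm_lt
    (show quotSeminorm p b v < quotSeminorm p b v + e / 2 by linarith)
  have h1 := quotSeminorm_le hadd hsmul b (u + v) (s + t)
  have h2 : u + v - (s + t) • b = (u - s • b) + (v - t • b) := by rw [add_smul]; abel
  have h3 := hadd (u - s • b) (v - t • b)
  rw [h2] at h1
  linarith

include hadd hsmul in
theorem quotSeminorm_smul (b : E) (t : ℝ) (v : E) :
    quotSeminorm p b (t • v) = |t| * quotSeminorm p b v := by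
  rcases eq_or_ne t 0 with rfl | ht
  · have h1 := quotSeminorm_le_self hadd hsmul b (0 : E)
    rw [seminorm_zero_of_smul hsmul] at h1
    have h2 : 0 ≤ quotSeminorm p b (0 : E) :=
      le_ciInf fun t => seminorm_nonneg_of_smul hadd hsmul _
    simp [le_antisymm h1 h2]
  · unfold quotSeminorm
    rw [Real.mul_iInf_of_nonneg (abs_nonneg t)]
    refine ((Equiv.mulLeft₀ t ht).surjective.iInf_congr _ fun s => ?_).symm
    rw [← hsmul, smul_sub, smul_smul]
    rfl

end QuotSeminorm

/-- A partially reduced system of vectors in a discrete subgroup `Λ`: the system is almost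
orthogonal, and either has the maximal length allowed or generates all vectors of `Λ` of length
at most `δ`. -/
theorem exists_reduced_system (r : ℕ) : ∃ C : ℝ, 1 ≤ C ∧
    ∀ {E : Type*} [AddCommGroup E] [Module ℝ E] (Λ : AddSubgroup E) (p : E → ℝ)
      (_ : ∀ u v, p (u + v) ≤ p u + p v) (_ : ∀ (t : ℝ) v, p (t • v) = |t| * p v)
      (_ : ∀ R : ℝ, ∃ F : Finset E, ∀ v ∈ Λ, p v ≤ R → ∃ f ∈ F, p (v - f) = 0)
      (δ : ℝ), ∃ j ≤ r, ∃ b : Fin j → E,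
        (∀ i, b i ∈ Λ) ∧ (∀ i, 0 < p (b i) ∧ p (b i) ≤ 3 ^ r * δ) ∧
        (∀ (n : Fin j → ℤ) i, |(n i : ℝ)| * p (b i) ≤ C * p (∑ i, n i • b i)) ∧
        (j = r ∨ ∀ v ∈ Λ, p v ≤ δ → ∃ n : Fin j → ℤ, p (v - ∑ i, n i • b i) = 0) := by
  induction r with
  | zero =>
    refine ⟨1, le_rfl, fun Λ p _ _ _ δ => ⟨0, le_rfl, Fin.elim0, fun i => i.elim0,
      fun i => i.elim0, fun n i => i.elim0, Or.inl rfl⟩⟩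
  | succ r ih =>
    obtain ⟨C, hC, ih⟩ := ih
    refine ⟨1 + 3 * (r + 1) * C, by nlinarith [show (0 : ℝ) ≤ r from r.cast_nonneg], ?_⟩
    intro E _ _ Λ p hadd hsmul hfin δ
    have hnn := seminorm_nonneg_of_smul hadd hsmul
    by_cases hex : ∃ v ∈ Λ, 0 < p v ∧ p v ≤ δ
    swap
    · push Not at hex
      refine ⟨0, Nat.zero_le _, Fin.elim0, fun i => i.elim0,
        fun i => i.elim0, fun n i => i.elim0, Or.inr fun v hv hp => ⟨Fin.elim0, ?_⟩⟩
      have := hnn v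
      by_contra hne
      have h1 : 0 < p v := lt_of_le_of_ne this (by simpa [eq_comm] using hne)
      linarith [hex v hv h1]
    obtain ⟨v₀, hv₀, hv₀pos, hv₀le⟩ := hex
    have hδ : 0 < δ := by linarith
    obtain ⟨b₀, hb₀, hb₀pos, hb₀le, hmin⟩ : ∃ b ∈ Λ, 0 < p b ∧ p b ≤ δ ∧
        ∀ v ∈ Λ, p v < p b → p v = 0 := by
      obtain ⟨F, hF⟩ := hfin δ
      have hSfin : {x : ℝ | ∃ v ∈ Λ, p v = x ∧ 0 < x ∧ x ≤ δ}.Finite := by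
        refine (F.image p).finite_toSet.subset ?_
        rintro x ⟨v, hv, rfl, -, hle⟩
        obtain ⟨f, hf, hvf⟩ := hF v hv hle
        simp only [Finset.coe_image, Set.mem_image, Finset.mem_coe]
        refine ⟨f, hf, ?_⟩
        have h1 := hadd (v - f) f
        have h2 := hadd (-(v - f)) v
        rw [seminorm_neg_of_smul hsmul] at h2
        simp only [sub_add_cancel, neg_sub] at h1 h2
        linarith
      obtain ⟨x, ⟨b, hb, rfl, hpos, hle⟩, hx⟩ :=
        Set.exists_min_image _ id hSfin ⟨p v₀, v₀, hv₀, rfl, hv₀pos, hv₀le⟩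
      refine ⟨b, hb, hpos, hle, fun v hv hlt => ?_⟩
      by_contra hne
      have h1 : 0 < p v := lt_of_le_of_ne (hnn v) (Ne.symm hne)
      have h2 := hx (p v) ⟨v, hv, rfl, h1, by linarith⟩
      simp only [id] at h2
      linarith
    have hadd' := quotSeminorm_add hadd hsmul b₀
    have hsmul' := quotSeminorm_smul hadd hsmul b₀
    have hle' := quotSeminorm_le_self hadd hsmul b₀
    have hkill : ∀ v ∈ Λ, quotSeminorm p b₀ v < p b₀ / 2 → ∃ n : ℤ, p (v - n • b₀) = 0 := by
      intro v hv h
      obtain ⟨n, hn⟩ := exists_int_of_quotSeminorm_lt hadd hsmul h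
      exact ⟨n, hmin _ (Λ.sub_mem hv (Λ.zsmul_mem hb₀ n)) (by linarith)⟩
    have hshift : ∀ (v : E) (n : ℤ), quotSeminorm p b₀ (v - n • b₀) = quotSeminorm p b₀ v := by
      have key : ∀ (v : E) (n : ℤ), quotSeminorm p b₀ (v - n • b₀) ≤ quotSeminorm p b₀ v := by
        intro v n
        refine le_ciInf fun t => ?_
        have h1 := quotSeminorm_le hadd hsmul b₀ (v - n • b₀) (t - n)
        have h2 : v - n • b₀ - (t - n) • b₀ = v - t • b₀ := by
          rw [sub_smul, Int.cast_smul_eq_zsmul]; abel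
        rwa [h2] at h1
      intro v n
      refine le_antisymm (key v n) ?_
      simpa using key (v - n • b₀) (-n)
    have hfin' : ∀ R : ℝ, ∃ F : Finset E, ∀ v ∈ Λ, quotSeminorm p b₀ v ≤ R →
        ∃ f ∈ F, quotSeminorm p b₀ (v - f) = 0 := by
      intro R
      obtain ⟨F, hF⟩ := hfin (R + 1 + p b₀ / 2)
      refine ⟨F, fun v hv hR => ?_⟩
      obtain ⟨n, hn⟩ := exists_int_of_quotSeminorm_lt hadd hsmul
        (show quotSeminorm p b₀ v < R + 1 by linarith)
      obtain ⟨f, hf, h0⟩ := hF _ (Λ.sub_mem hv (Λ.zsmul_mem hb₀ n)) hn.le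
      refine ⟨f, hf, ?_⟩
      rw [← hshift _ n, sub_right_comm]
      exact le_antisymm (h0 ▸ hle' _) (seminorm_nonneg_of_smul hadd' hsmul' _)
    obtain ⟨j, hj, b, hbΛ, hbp, hbC, hgen⟩ := ih Λ (quotSeminorm p b₀) hadd' hsmul' hfin' δ
    have hlow : ∀ i, p b₀ / 2 ≤ quotSeminorm p b₀ (b i) := by
      intro i
      by_contra! h
      obtain ⟨n, hn⟩ := hkill _ (hbΛ i) h
      have h1 := hle' (b i - n • b₀)
      rw [hshift, hn] at h1
      linarith [(hbp i).1]
    have hlift : ∀ i, ∃ n : ℤ, p (b i - n • b₀) ≤ 3 * quotSeminorm p b₀ (b i) := by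
      intro i
      obtain ⟨n, hn⟩ := exists_int_of_quotSeminorm_lt hadd hsmul
        (show quotSeminorm p b₀ (b i) < quotSeminorm p b₀ (b i) + p b₀ / 2 by linarith)
      exact ⟨n, by linarith [hlow i]⟩
    choose k hk using hlift
    set c : Fin j → E := fun i => b i - k i • b₀ with hc
    have hcq : ∀ i, quotSeminorm p b₀ (c i) = quotSeminorm p b₀ (b i) := fun i => hshift _ _
    have hsum : ∀ n : Fin j → ℤ,
        ∑ i, n i • c i = ∑ i, n i • b i - (∑ i, n i * k i) • b₀ := by
      intro n
      simp only [hc, smul_sub, Finset.sum_sub_distrib, smul_smul, Finset.sum_smul]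
    have htail : ∀ (m : ℤ) (n : Fin j → ℤ) i,
        |(n i : ℝ)| * p (c i) ≤ 3 * C * p (m • b₀ + ∑ i, n i • c i) := by
      intro m n i
      have h1 := hbC n i
      have h2 : quotSeminorm p b₀ (∑ i, n i • b i) ≤ p (m • b₀ + ∑ i, n i • c i) := by
        rw [hsum, ← hshift _ (∑ i, n i * k i - m)]
        convert hle' _ using 2
        rw [sub_smul]; abel
      calc |(n i : ℝ)| * p (c i) ≤ |(n i : ℝ)| * (3 * quotSeminorm p b₀ (b i)) :=
            mul_le_mul_of_nonneg_left (hk i) (abs_nonneg _)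
        _ ≤ 3 * (C * quotSeminorm p b₀ (∑ i, n i • b i)) := by linarith
        _ ≤ 3 * (C * p (m • b₀ + ∑ i, n i • c i)) := by gcongr
        _ = _ := by ring
    refine ⟨j + 1, Nat.succ_le_succ hj, Fin.cons b₀ c, ?_, ?_, ?_, ?_⟩
    · intro i
      refine Fin.cases hb₀ (fun i => ?_) i
      exact Λ.sub_mem (hbΛ i) (Λ.zsmul_mem hb₀ _)
    · have h3 : (1 : ℝ) ≤ 3 ^ (r + 1) := one_le_pow₀ (by norm_num)
      intro i
      refine Fin.cases ⟨hb₀pos, ?_⟩ (fun i => ⟨?_, ?_⟩) i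
      · simp only [Fin.cons_zero]; nlinarith
      · simp only [Fin.cons_succ]
        exact lt_of_lt_of_le (hcq i ▸ (hbp i).1) (hle' _)
      · simp only [Fin.cons_succ]
        have := (hbp i).2
        have := hk i
        rw [pow_succ]
        linarith
    · intro n i
      simp only [Fin.sum_univ_succ, Fin.cons_zero, Fin.cons_succ]
      set w := n 0 • b₀ + ∑ i : Fin j, n i.succ • c i with hw
      have hwnn := hnn w
      refine Fin.cases ?_ (fun i => ?_) i
      · simp only [Fin.cons_zero]
        have h1 : p (n 0 • b₀) ≤ p w + p (∑ i : Fin j, n i.succ • c i) := by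
          have := hadd w (-∑ i : Fin j, n i.succ • c i)
          rw [seminorm_neg_of_smul hsmul] at this
          simpa [hw] using this
        have h2 : p (∑ i : Fin j, n i.succ • c i) ≤ ∑ i : Fin j, 3 * C * p w := by
          refine (seminorm_sum_le_of_smul hadd hsmul _ _).trans (Finset.sum_le_sum fun i _ => ?_)
          rw [seminorm_zsmul_of_smul hsmul]
          exact htail (n 0) (fun i => n i.succ) i
        rw [seminorm_zsmul_of_smul hsmul] at h1
        simp only [Finset.sum_const, Finset.card_univ, Fintype.card_fin, nsmul_eq_mul] at h2
        have h3 : (j : ℝ) ≤ r + 1 := by exact_mod_cast hj.trans (Nat.le_succ r)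
        have h4 : (j : ℝ) * (3 * C * p w) ≤ (r + 1) * (3 * C * p w) :=
          mul_le_mul_of_nonneg_right h3 (by positivity)
        linarith
      · simp only [Fin.cons_succ]
        refine (htail (n 0) (fun i => n i.succ) i).trans ?_
        refine mul_le_mul_of_nonneg_right ?_ hwnn
        nlinarith [show (0 : ℝ) ≤ r from r.cast_nonneg]
    · rcases hgen with rfl | hgen
      · exact Or.inl rfl
      refine Or.inr fun v hv hle => ?_
      obtain ⟨n, hn⟩ := hgen v hv ((hle' v).trans hle)
      obtain ⟨m, hm⟩ := hkill (v - ∑ i, n i • b i)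
        (Λ.sub_mem hv (Λ.sum_mem fun i _ => Λ.zsmul_mem (hbΛ i) _)) (by rw [hn]; linarith)
      refine ⟨Fin.cons (m + ∑ i, n i * k i) n, ?_⟩
      simp only [Fin.sum_univ_succ, Fin.cons_zero, Fin.cons_succ]
      rw [hsum, ← hm]
      congr 1
      rw [add_smul]
      abel

end Reduction

section Bohr

variable {G : Type*} [AddCommGroup G]

/-- `v` is a vector of real arguments (in turns) of the values at `g` of the characters in `T`. -/
def IsPhaseLift (T : Finset (AddChar G ℂ)) (g : G) (v : T → ℝ) : Prop :=
  ∀ χ : T, χ.1 g = Complex.exp ((v χ : ℂ) * (2 * Real.pi * Complex.I))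

namespace IsPhaseLift

variable {T : Finset (AddChar G ℂ)} {g h : G} {v w : T → ℝ}

theorem zero : IsPhaseLift T (0 : G) 0 := fun χ => by simp

theorem add (hg : IsPhaseLift T g v) (hh : IsPhaseLift T h w) : IsPhaseLift T (g + h) (v + w) :=
  fun χ => by
    rw [AddChar.map_add_eq_mul, hg χ, hh χ, ← Complex.exp_add]
    congr 1
    simp only [Pi.add_apply, Complex.ofReal_add]
    ring

theorem neg (hg : IsPhaseLift T g v) : IsPhaseLift T (-g) (-v) := fun χ => by
  have h1 : χ.1 (-g) * χ.1 g = 1 := by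
    rw [← AddChar.map_add_eq_mul]; simp
  rw [eq_inv_of_mul_eq_one_left h1, hg χ, ← Complex.exp_neg]
  congr 1
  simp

theorem sub (hg : IsPhaseLift T g v) (hh : IsPhaseLift T h w) : IsPhaseLift T (g - h) (v - w) := by
  simpa only [sub_eq_add_neg] using hg.add hh.neg

theorem nsmul (hg : IsPhaseLift T g v) (n : ℕ) : IsPhaseLift T (n • g) (n • v) := by
  induction n with
  | zero => simpa using zero
  | succ n ih => simpa only [succ_nsmul] using ih.add hg

theorem zsmul (hg : IsPhaseLift T g v) (n : ℤ) : IsPhaseLift T (n • g) (n • v) := by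
  obtain ⟨n, rfl | rfl⟩ := n.eq_nat_or_neg
  · simpa using hg.nsmul n
  · simpa using (hg.nsmul n).neg

theorem sum {ι : Type*} (s : Finset ι) {a : ι → G} {b : ι → T → ℝ}
    (hab : ∀ i, IsPhaseLift T (a i) (b i)) : IsPhaseLift T (∑ i ∈ s, a i) (∑ i ∈ s, b i) := by
  classical
  induction s using Finset.induction_on with
  | empty => simpa using zero
  | insert i s hi ih =>
    rw [Finset.sum_insert hi, Finset.sum_insert hi]
    exact (hab i).add ih

theorem exists_int (hg : IsPhaseLift T g v) (hh : IsPhaseLift T g w) (χ : T) :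
    ∃ n : ℤ, v χ = w χ + n := by
  have h1 := hg χ
  rw [hh χ, eq_comm, Complex.exp_eq_exp_iff_exists_int] at h1
  obtain ⟨n, hn⟩ := h1
  refine ⟨n, ?_⟩
  have h2 : (v χ : ℂ) = w χ + n := by
    have h3 : (2 * Real.pi * Complex.I : ℂ) ≠ 0 := Complex.two_pi_I_ne_zero
    apply mul_right_cancel₀ h3
    rw [hn]; ring
  exact_mod_cast h2

theorem eq_of_norm_sub_lt (hg : IsPhaseLift T g v) (hh : IsPhaseLift T g w) (h : ‖v - w‖ < 1) :
    v = w := by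
  funext χ
  obtain ⟨n, hn⟩ := exists_int hg hh χ
  have h1 := (norm_le_pi_norm (v - w) χ).trans_lt h
  rw [Pi.sub_apply, hn, add_sub_cancel_left, Real.norm_eq_abs] at h1
  have h2 : |n| < 1 := by exact_mod_cast h1
  rw [hn, Int.abs_lt_one_iff.mp h2]
  simp

end IsPhaseLift

theorem exists_isPhaseLift [Finite G] (T : Finset (AddChar G ℂ)) (g : G) :
    ∃ v : T → ℝ, IsPhaseLift T g v ∧ ∀ χ, |v χ| ≤ 1 / 2 := by
  refine ⟨fun χ => Complex.arg (χ.1 g) / (2 * Real.pi), fun χ => ?_, fun χ => ?_⟩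
  · have h1 : ‖χ.1 g‖ = 1 := AddChar.norm_apply _ _
    have h2 := Complex.norm_mul_exp_arg_mul_I (χ.1 g)
    rw [h1, Complex.ofReal_one, one_mul] at h2
    have h3 : (Real.pi : ℂ) ≠ 0 := by exact_mod_cast Real.pi_ne_zero
    conv_lhs => rw [← h2]
    congr 1
    push_cast
    field_simp
  · have h1 := Complex.abs_arg_le_pi (χ.1 g)
    have h2 := Real.pi_pos
    rw [abs_div, abs_of_pos (by positivity : 0 < 2 * Real.pi), div_le_iff₀ (by positivity)]
    linarith

/-- The common kernel of the characters in `T`. -/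
def phaseKernel (T : Finset (AddChar G ℂ)) : AddSubgroup G where
  carrier := {g | IsPhaseLift T g 0}
  zero_mem' := IsPhaseLift.zero
  add_mem' hg hh := by simpa using IsPhaseLift.add hg hh
  neg_mem' hg := by simpa using IsPhaseLift.neg hg

theorem mem_phaseKernel {T : Finset (AddChar G ℂ)} {g : G} :
    g ∈ phaseKernel T ↔ IsPhaseLift T g 0 := Iff.rfl

/-- The group of all argument vectors of elements of `G`. -/
def phaseLattice (T : Finset (AddChar G ℂ)) : AddSubgroup (T → ℝ) where
  carrier := {v | ∃ g, IsPhaseLift T g v}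
  zero_mem' := ⟨0, IsPhaseLift.zero⟩
  add_mem' := fun ⟨_, hg⟩ ⟨_, hh⟩ => ⟨_, hg.add hh⟩
  neg_mem' := fun ⟨_, hg⟩ => ⟨_, hg.neg⟩

theorem phaseLattice_finite [Fintype G] (T : Finset (AddChar G ℂ)) (R : ℝ) :
    ∃ F : Finset (T → ℝ), ∀ v ∈ phaseLattice T, ‖v‖ ≤ R → ∃ f ∈ F, ‖v - f‖ = 0 := by
  classical
  choose u hu hu2 using exists_isPhaseLift T
  set N : ℤ := ⌈R + 1 / 2⌉
  refine ⟨(Finset.univ ×ˢ Fintype.piFinset fun _ : T => Finset.Icc (-N) N).image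
    fun q : G × (T → ℤ) => u q.1 + fun χ => (q.2 χ : ℝ), ?_⟩
  rintro v ⟨g, hg⟩ hR
  choose n hn using hg.exists_int (hu g)
  refine ⟨v, ?_, by simp⟩
  refine Finset.mem_image.mpr ⟨(g, n), ?_, (funext hn).symm⟩
  simp only [Finset.mem_product, Finset.mem_univ, Fintype.mem_piFinset, Finset.mem_Icc, true_and]
  intro χ
  have h1 := (norm_le_pi_norm v χ).trans hR
  rw [Real.norm_eq_abs] at h1
  have h2 := hu2 g χ
  have h3 := Int.le_ceil (R + 1 / 2)
  rw [abs_le] at h1 h2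
  have h4 := hn χ
  constructor
  · have : (-(N : ℝ)) ≤ n χ := by linarith
    exact_mod_cast this
  · have : (n χ : ℝ) ≤ N := by linarith
    exact_mod_cast this

/-- The Bohr set of radius `δ` (in turns) of a set of characters. -/
noncomputable def bohrSet [Fintype G] (T : Finset (AddChar G ℂ)) (δ : ℝ) : Finset G :=
  open Classical in Finset.univ.filter fun g => ∃ v : T → ℝ, IsPhaseLift T g v ∧ ‖v‖ ≤ δ

theorem mem_bohrSet [Fintype G] {T : Finset (AddChar G ℂ)} {δ : ℝ} {g : G} :
    g ∈ bohrSet T δ ↔ ∃ v : T → ℝ, IsPhaseLift T g v ∧ ‖v‖ ≤ δ := by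
  simp [bohrSet]

theorem norm_sum_zsmul_le {ι E : Type*} [Fintype ι] [NormedAddCommGroup E] [NormedSpace ℝ E]
    (n : ι → ℤ) (b : ι → E) : ‖∑ i, n i • b i‖ ≤ ∑ i, |(n i : ℝ)| * ‖b i‖ := by
  refine (norm_sum_le _ _).trans (Finset.sum_le_sum fun i _ => ?_)
  rw [← Int.cast_smul_eq_zsmul ℝ, norm_smul, Real.norm_eq_abs]

/-- A Bohr set whose size does not drop too fast at one suitable smaller radius has, near the
origin, a reduced generating system of bounded rank. -/
theorem exists_reduced_system_bohrSet (B κ : ℝ) (hB : 0 ≤ B) (hκ : 0 < κ) :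
    ∃ δ : ℝ, 0 < δ ∧ δ ≤ 1 / 20 ∧ ∃ C : ℝ, 1 ≤ C ∧ ∀ {G : Type*} [AddCommGroup G] [Fintype G]
      (T : Finset (AddChar G ℂ)),
      (κ * δ) ^ B * (bohrSet T (1 / 10)).card ≤ (bohrSet T δ).card →
      ∃ j : ℕ, (j : ℝ) ≤ B ∧ ∃ (a : Fin j → G) (b : Fin j → T → ℝ),
        (∀ i, IsPhaseLift T (a i) (b i)) ∧ (∀ i, 0 < ‖b i‖) ∧
        (∀ (n : Fin j → ℤ) i, |(n i : ℝ)| * ‖b i‖ ≤ C * ‖∑ i, n i • b i‖) ∧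
        ∀ g v, IsPhaseLift T g v → ‖v‖ ≤ δ → ∃ n : Fin j → ℤ, v = ∑ i, n i • b i := by
  set r := ⌊B⌋₊ + 1 with hr
  have hrB : B < r := by
    have := Nat.lt_floor_add_one B
    rw [hr]; push_cast; exact this
  obtain ⟨C, hC, hred⟩ := exists_reduced_system r
  have hr0 : (1 : ℝ) ≤ r := by rw [hr]; push_cast; linarith [(⌊B⌋₊).cast_nonneg (α := ℝ)]
  have h3r : (0 : ℝ) < 3 ^ r := by positivity
  set D : ℝ := 20 * r * (3 * C + 3 ^ r) with hD
  have hDpos : 0 < D := by positivity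
  have hD20 : 20 ≤ D := by
    have : 1 ≤ 3 * C + (3 : ℝ) ^ r := by linarith
    rw [hD]; nlinarith
  obtain ⟨L, hL1, hL⟩ : ∃ L : ℕ, 1 ≤ L ∧ 1 < (L : ℝ) ^ ((r : ℝ) - B) * (κ / D) ^ B := by
    have h1 : Filter.Tendsto (fun L : ℕ => (L : ℝ) ^ ((r : ℝ) - B) * (κ / D) ^ B)
        Filter.atTop Filter.atTop :=
      ((tendsto_rpow_atTop (by linarith)).comp tendsto_natCast_atTop_atTop).atTop_mul_const
        (Real.rpow_pos_of_pos (by positivity) _)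
    obtain ⟨L, h2, h3⟩ := ((h1.eventually_gt_atTop 1).and (Filter.eventually_ge_atTop 1)).exists
    exact ⟨L, h3, h2⟩
  have hL0 : (1 : ℝ) ≤ L := by exact_mod_cast hL1
  set δ : ℝ := 1 / (D * L) with hδ
  have hδpos : 0 < δ := by positivity
  have hδ20 : δ ≤ 1 / 20 := by
    rw [hδ]
    apply one_div_le_one_div_of_le (by norm_num)
    nlinarith
  refine ⟨δ, hδpos, hδ20, C, hC, ?_⟩
  intro G _ _ T hgrow
  obtain ⟨j, hjr, b, hbΛ, hbn, hbC, hgen⟩ := hred (phaseLattice T) (fun v => ‖v‖) norm_add_le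
    (fun t v => by rw [norm_smul, Real.norm_eq_abs]) (phaseLattice_finite T) δ
  choose a ha using hbΛ
  have hjne : j ≠ r := by
    rintro rfl
    set M : Fin r → ℤ := fun i => ⌈3 * C * δ / ‖b i‖⌉ with hM
    have hMlow : ∀ i, 3 * C * δ ≤ M i * ‖b i‖ := fun i => by
      rw [← div_le_iff₀ (hbn i).1]; exact Int.le_ceil _
    have hMpos : ∀ i, (0 : ℝ) ≤ M i := fun i => by
      have : (0 : ℝ) ≤ 3 * C * δ / ‖b i‖ := by positivity
      exact this.trans (Int.le_ceil _)
    have hMup : ∀ i, M i * ‖b i‖ ≤ (3 * C + 3 ^ r) * δ := fun i => by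
      have h1 : (M i : ℝ) ≤ 3 * C * δ / ‖b i‖ + 1 := (Int.ceil_lt_add_one _).le
      have h2 := mul_le_mul_of_nonneg_right h1 (hbn i).1.le
      rw [add_mul, div_mul_cancel₀ _ (hbn i).1.ne', one_mul] at h2
      linarith [(hbn i).2]
    have hlift : ∀ (n : Fin r → Fin L) (g : G) (v : T → ℝ), IsPhaseLift T g v →
        IsPhaseLift T (∑ i, ((n i : ℕ) * M i : ℤ) • a i + g)
          (∑ i, ((n i : ℕ) * M i : ℤ) • b i + v) := fun n g v hv =>
      (IsPhaseLift.sum _ fun i => (ha i).zsmul _).add hv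
    have hnorm : ∀ (n : Fin r → Fin L) (v : T → ℝ), ‖v‖ ≤ δ →
        ‖∑ i, ((n i : ℕ) * M i : ℤ) • b i + v‖ ≤ 1 / 10 := by
      intro n v hv
      have h1 : ‖∑ i, ((n i : ℕ) * M i : ℤ) • b i‖ ≤ ∑ _i : Fin r, L * ((3 * C + 3 ^ r) * δ) := by
        refine (norm_sum_zsmul_le _ _).trans (Finset.sum_le_sum fun i _ => ?_)
        push_cast
        rw [abs_of_nonneg (mul_nonneg (Nat.cast_nonneg _) (hMpos i)), mul_assoc]
        have h3 : ((n i : ℕ) : ℝ) ≤ L := by exact_mod_cast (n i).2.le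
        exact mul_le_mul h3 (hMup i) (mul_nonneg (hMpos i) (norm_nonneg _)) (by positivity)
      rw [Finset.sum_const, Finset.card_univ, Fintype.card_fin, nsmul_eq_mul] at h1
      have h2 : (r : ℝ) * (L * ((3 * C + 3 ^ r) * δ)) = 1 / 20 := by
        rw [hδ, hD]; field_simp
      have h3 := norm_add_le (∑ i, ((n i : ℕ) * M i : ℤ) • b i) v
      linarith
    have hcard : Fintype.card ((Fin r → Fin L) × bohrSet T δ) ≤
        Fintype.card (bohrSet T (1 / 10)) := by
      refine Fintype.card_le_of_injective (fun q => ⟨∑ i, ((q.1 i : ℕ) * M i : ℤ) • a i + q.2.1, ?_⟩)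
        ?_
      · obtain ⟨v, hv, hvn⟩ := mem_bohrSet.mp q.2.2
        exact mem_bohrSet.mpr ⟨_, hlift q.1 _ v hv, hnorm q.1 v hvn⟩
      · rintro ⟨n, g, hg⟩ ⟨n', g', hg'⟩ heq
        simp only [Subtype.mk.injEq] at heq
        obtain ⟨v, hv, hvn⟩ := mem_bohrSet.mp hg
        obtain ⟨v', hv', hvn'⟩ := mem_bohrSet.mp hg'
        have h1 := hlift n g v hv
        rw [heq] at h1
        have h2 := h1.eq_of_norm_sub_lt (hlift n' g' v' hv') (by
          have := norm_sub_le (∑ i, ((n i : ℕ) * M i : ℤ) • b i + v)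
            (∑ i, ((n' i : ℕ) * M i : ℤ) • b i + v')
          linarith [hnorm n v hvn, hnorm n' v' hvn'])
        have h3 : ∑ i, (((n i : ℕ) * M i : ℤ) - ((n' i : ℕ) * M i : ℤ)) • b i = v' - v := by
          simp only [sub_smul, Finset.sum_sub_distrib]
          rw [sub_eq_sub_iff_add_eq_add, h2]; abel
        have h4 : ∀ i, n i = n' i := by
          intro i
          by_contra hne
          have h5 := hbC (fun i => ((n i : ℕ) * M i : ℤ) - ((n' i : ℕ) * M i : ℤ)) i
          simp only [h3] at h5
          have h6 : ‖v' - v‖ ≤ 2 * δ := (norm_sub_le _ _).trans (by linarith)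
          have h7 : (1 : ℝ) ≤ |((n i : ℕ) : ℝ) - ((n' i : ℕ) : ℝ)| := by
            have : (1 : ℤ) ≤ |((n i : ℕ) : ℤ) - ((n' i : ℕ) : ℤ)| := by
              apply Int.one_le_abs
              intro h
              apply hne
              apply Fin.ext
              omega
            exact_mod_cast this
          push_cast at h5
          rw [← sub_mul, abs_mul, abs_of_nonneg (hMpos i), mul_assoc] at h5
          have h8 := hMlow i
          have h9 : C * ‖v' - v‖ ≤ C * (2 * δ) := by gcongr
          have h10 : 0 < C * δ := by positivity
          nlinarith
        obtain rfl : n = n' := funext h4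
        have : g = g' := add_left_cancel heq
        subst this
        rfl
    simp only [Fintype.card_prod, Fintype.card_fun, Fintype.card_fin, Fintype.card_coe] at hcard
    have hpos : 0 < (bohrSet T (1 / 10)).card := Finset.card_pos.mpr
      ⟨0, mem_bohrSet.mpr ⟨0, IsPhaseLift.zero, by simp⟩⟩
    have hcard' : (L : ℝ) ^ r * (bohrSet T δ).card ≤ (bohrSet T (1 / 10)).card := by
      exact_mod_cast hcard
    have hpos' : (0 : ℝ) < (bohrSet T (1 / 10)).card := by exact_mod_cast hpos
    have h1 : (L : ℝ) ^ r * (κ * δ) ^ B ≤ 1 := by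
      by_contra! h
      have h2 := mul_le_mul_of_nonneg_left hgrow (by positivity : (0 : ℝ) ≤ (L : ℝ) ^ r)
      nlinarith
    have h2 : κ * δ = (κ / D) * (L : ℝ)⁻¹ := by rw [hδ]; field_simp
    rw [h2, Real.mul_rpow (by positivity) (by positivity), Real.inv_rpow (by positivity)] at h1
    rw [Real.rpow_sub (by positivity), Real.rpow_natCast] at hL
    have h3 : (L : ℝ) ^ r / (L : ℝ) ^ B * (κ / D) ^ B =
        (L : ℝ) ^ r * ((κ / D) ^ B * ((L : ℝ) ^ B)⁻¹) := by
      rw [div_eq_mul_inv]; ring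
    linarith
  refine ⟨j, ?_, a, b, ha, fun i => (hbn i).1, hbC, ?_⟩
  · have h1 : j ≤ ⌊B⌋₊ := by omega
    exact (Nat.le_floor_iff hB).mp h1
  · intro g v hg hv
    obtain ⟨n, hn⟩ := (hgen.resolve_left hjne) v ⟨g, hg⟩ hv
    exact ⟨n, sub_eq_zero.mp (norm_eq_zero.mp hn)⟩

end Bohr

section Progression

variable {G : Type*} [AddCommGroup G]

/-- A coset-progression all of whose expressions are distinct is proper, and its size is the
product of its dimensions. -/
theorem isProperCosetProg_of_injOn [Finite G] {r : ℕ} (H : AddSubgroup G) (a : Fin r → G)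
    (N : Fin r → ℕ)
    (hinj : ∀ h ∈ H, ∀ h' ∈ H, ∀ n n' : Fin r → ℤ, (∀ i, |n i| ≤ N i) → (∀ i, |n' i| ≤ N i) →
      h + ∑ i, n i • a i = h' + ∑ i, n' i • a i → h = h' ∧ n = n') :
    let Q : GAPData G r := ⟨0, a, fun i => -(N i : ℤ), fun i => (N i : ℤ), fun i => by omega⟩
    IsProperCosetProg H Q ∧
      ((H : Set G) + Q.toSet).ncard = (H : Set G).ncard * ∏ i, (2 * N i + 1) := by
  classical
  intro Q
  set box : Finset (Fin r → ℤ) := Fintype.piFinset fun i => Finset.Icc (-(N i : ℤ)) (N i) with hbox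
  have hmem : ∀ n, n ∈ (box : Set (Fin r → ℤ)) ↔ ∀ i, |n i| ≤ N i := by
    intro n
    rw [Finset.mem_coe, hbox, Fintype.mem_piFinset]
    simp [abs_le]
  have hcard : (box : Set (Fin r → ℤ)).ncard = ∏ i, (2 * N i + 1) := by
    rw [Set.ncard_coe_finset, hbox, Fintype.card_piFinset]
    refine Finset.prod_congr rfl fun i _ => ?_
    rw [Int.card_Icc]; omega
  have hQ : Q.toSet = (fun n : Fin r → ℤ => ∑ i, n i • a i) '' (box : Set (Fin r → ℤ)) := by
    ext x
    simp only [GAPData.toSet, Q, Set.mem_ofPred_eq, Set.mem_image, hmem, zero_add, abs_le]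
    exact ⟨fun ⟨m, h1, h2⟩ => ⟨m, h1, h2.symm⟩, fun ⟨m, h1, h2⟩ => ⟨m, h1, h2.symm⟩⟩
  have hQcard : Q.toSet.ncard = ∏ i, (2 * N i + 1) := by
    rw [hQ, Set.InjOn.ncard_image, hcard]
    intro n hn n' hn' heq
    exact (hinj 0 H.zero_mem 0 H.zero_mem n n' ((hmem n).mp hn) ((hmem n').mp hn')
      (by simpa using heq)).2
  have hHQ : ((H : Set G) + Q.toSet).ncard = (H : Set G).ncard * ∏ i, (2 * N i + 1) := by
    have h1 : (H : Set G) + Q.toSet = (fun q : G × (Fin r → ℤ) => q.1 + ∑ i, q.2 i • a i) ''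
        ((H : Set G) ×ˢ (box : Set (Fin r → ℤ))) := by
      rw [hQ]
      ext x
      simp only [Set.mem_add, Set.mem_image, Set.mem_prod, Prod.exists]
      constructor
      · rintro ⟨h, hh, _, ⟨n, hn, rfl⟩, rfl⟩
        exact ⟨h, n, ⟨hh, hn⟩, rfl⟩
      · rintro ⟨h, n, ⟨hh, hn⟩, rfl⟩
        exact ⟨h, hh, _, ⟨n, hn, rfl⟩, rfl⟩
    rw [h1, Set.InjOn.ncard_image, Set.ncard_prod, hcard]
    rintro ⟨h, n⟩ ⟨hh, hn⟩ ⟨h', n'⟩ ⟨hh', hn'⟩ heq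
    obtain ⟨h2, h3⟩ := hinj h hh h' hh' n n' ((hmem n).mp hn) ((hmem n').mp hn') heq
    rw [h2, h3]
  refine ⟨⟨Set.toFinite _, ?_, by rw [hHQ, hQcard]⟩, hHQ⟩
  intro m m' hm hm' heq
  exact (hinj 0 H.zero_mem 0 H.zero_mem m m' (fun i => abs_le.mpr (hm i))
    (fun i => abs_le.mpr (hm' i)) (by simpa [Q] using heq)).2

theorem phaseKernel_box_injective {T : Finset (AddChar G ℂ)} {ι : Type*} [Fintype ι] {a : ι → G}
    {b : ι → T → ℝ} {C : ℝ} (hab : ∀ i, IsPhaseLift T (a i) (b i)) (hb : ∀ i, 0 < ‖b i‖)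
    (hbC : ∀ (n : ι → ℤ) i, |(n i : ℝ)| * ‖b i‖ ≤ C * ‖∑ i, n i • b i‖) (N : ι → ℕ)
    (hN : ∑ i, 2 * N i * ‖b i‖ < 1) {h h' : G} (hh : h ∈ phaseKernel T) (hh' : h' ∈ phaseKernel T)
    (n n' : ι → ℤ) (hn : ∀ i, |n i| ≤ N i) (hn' : ∀ i, |n' i| ≤ N i)
    (heq : h + ∑ i, n i • a i = h' + ∑ i, n' i • a i) : h = h' ∧ n = n' := by
  have h1 : IsPhaseLift T (∑ i, (n i - n' i) • a i) (∑ i, (n i - n' i) • b i) :=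
    IsPhaseLift.sum _ fun i => (hab i).zsmul _
  have h2 : ∑ i, (n i - n' i) • a i = h' - h := by
    simp only [sub_smul, Finset.sum_sub_distrib]
    rw [sub_eq_sub_iff_add_eq_add, add_comm, heq]
  rw [h2] at h1
  have h3 : ‖∑ i, (n i - n' i) • b i‖ < 1 := by
    refine lt_of_le_of_lt ((norm_sum_zsmul_le _ _).trans (Finset.sum_le_sum fun i _ => ?_)) hN
    refine mul_le_mul_of_nonneg_right ?_ (norm_nonneg _)
    have h4 : |n i - n' i| ≤ 2 * N i := (abs_sub _ _).trans (by linarith [hn i, hn' i])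
    exact_mod_cast h4
  have h4 := h1.eq_of_norm_sub_lt (mem_phaseKernel.mp ((phaseKernel T).sub_mem hh' hh))
    (by rwa [sub_zero])
  have h5 : n = n' := by
    funext i
    have h5 := hbC (fun i => n i - n' i) i
    simp only [h4, norm_zero, mul_zero] at h5
    have h6 : |((n i - n' i : ℤ) : ℝ)| ≤ 0 := by
      by_contra! h6
      exact absurd h5 (not_le.mpr (mul_pos h6 (hb i)))
    have h7 := abs_nonpos_iff.mp h6
    rw [Int.cast_eq_zero] at h7
    linarith
  subst h5
  exact ⟨add_right_cancel heq, rfl⟩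

/-- A small dilate of a Bohr set of bounded doubling lies in a proper coset-progression of bounded
rank and of the expected size. -/
theorem exists_cosetProg_of_bohrSet (B κ : ℝ) (hB : 0 ≤ B) (hκ : 0 < κ) :
    ∃ δ : ℝ, 0 < δ ∧ δ ≤ 1 / 20 ∧ ∃ ρ₀ : ℝ, 0 < ρ₀ ∧ ∃ K : ℝ, 0 < K ∧
      ∀ {G : Type*} [AddCommGroup G] [Fintype G] (T : Finset (AddChar G ℂ)),
      (κ * δ) ^ B * (bohrSet T (1 / 10)).card ≤ (bohrSet T δ).card →
      ∀ ρ : ℝ, 0 < ρ → ρ ≤ ρ₀ →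
      ∃ (r : ℕ) (H : AddSubgroup G) (Q : GAPData G r), (r : ℝ) ≤ B ∧ Q.IsSymmetric ∧
        IsProperCosetProg H Q ∧ (∀ g ∈ bohrSet T ρ, g ∈ (H : Set G) + Q.toSet) ∧
        (((H : Set G) + Q.toSet).ncard : ℝ) ≤ K * ρ ^ r * (bohrSet T (1 / 10)).card := by
  obtain ⟨δ, hδ, hδ20, C, hC, hred⟩ := exists_reduced_system_bohrSet B κ hB hκ
  refine ⟨δ, hδ, hδ20, min δ (1 / (4 * C * (B + 1))), by positivity,
    (30 * C * (B + 1)) ^ ⌊B⌋₊, by positivity, ?_⟩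
  intro G _ _ T hgrow ρ hρ hρ₀
  obtain ⟨j, hjB, a, b, hab, hb, hbC, hgen⟩ := hred T hgrow
  have hρδ : ρ ≤ δ := hρ₀.trans (min_le_left _ _)
  have hρC : ρ * (4 * C * (B + 1)) ≤ 1 := by
    rw [← le_div_iff₀ (by positivity)]; exact hρ₀.trans (min_le_right _ _)
  classical
  set S : Finset (Fin j) := Finset.univ.filter fun i => ‖b i‖ ≤ C * ρ with hS
  set r := S.card with hr
  set e : Fin r ↪o Fin j := S.orderEmbOfFin rfl with he
  have heS : ∀ i, ‖b (e i)‖ ≤ C * ρ := fun i => by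
    have : e i ∈ S := S.orderEmbOfFin_mem rfl i
    simpa [hS] using this
  have hrange : ∀ i, ‖b i‖ ≤ C * ρ → i ∈ Set.range e := fun i hi => by
    rw [he, Finset.range_orderEmbOfFin]
    simpa [hS] using hi
  have hrj : r ≤ j := by simpa using S.card_le_univ
  have hrB : (r : ℝ) ≤ B := le_trans (by exact_mod_cast hrj) hjB
  have hbC' : ∀ (n : Fin r → ℤ) i, |(n i : ℝ)| * ‖b (e i)‖ ≤ C * ‖∑ i, n i • b (e i)‖ := by
    intro n i
    have h1 := hbC (Function.extend e n 0) (e i)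
    rw [e.injective.extend_apply] at h1
    rwa [← Fintype.sum_of_injective e e.injective (fun i => n i • b (e i)) _ (fun i hi => ?_)
      (fun i => by rw [e.injective.extend_apply])] at h1
    rw [Function.extend_apply' _ _ _ hi]; simp
  set N : Fin r → ℕ := fun i => ⌊C * ρ / ‖b (e i)‖⌋₊ with hNdef
  have hN1 : ∀ i, (N i : ℝ) * ‖b (e i)‖ ≤ C * ρ := fun i => by
    rw [← le_div_iff₀ (hb _)]
    exact Nat.floor_le (div_nonneg (by positivity) (norm_nonneg _))
  set M : Fin r → ℕ := fun i => ⌊1 / (10 * (B + 1) * ‖b (e i)‖)⌋₊ with hMdef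
  have hM1 : ∀ i, (M i : ℝ) * ‖b (e i)‖ ≤ 1 / (10 * (B + 1)) := fun i => by
    have h1 : (M i : ℝ) ≤ 1 / (10 * (B + 1) * ‖b (e i)‖) :=
      Nat.floor_le (div_nonneg zero_le_one (mul_nonneg (by positivity) (norm_nonneg _)))
    rw [← div_div] at h1
    rwa [← le_div_iff₀ (hb _)]
  have hsumN : ∑ i, 2 * N i * ‖b (e i)‖ < 1 := by
    calc ∑ i, 2 * N i * ‖b (e i)‖ ≤ ∑ _i : Fin r, 2 * (C * ρ) :=
          Finset.sum_le_sum fun i _ => by linarith [hN1 i]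
      _ = r * (2 * (C * ρ)) := by simp
      _ ≤ (B + 1) * (2 * (C * ρ)) := by gcongr; linarith
      _ < 1 := by linarith
  have hsumM' : ∑ i, (M i : ℝ) * ‖b (e i)‖ ≤ 1 / 10 := by
    calc ∑ i, (M i : ℝ) * ‖b (e i)‖ ≤ ∑ _i : Fin r, 1 / (10 * (B + 1)) :=
          Finset.sum_le_sum fun i _ => hM1 i
      _ = r * (1 / (10 * (B + 1))) := by simp
      _ ≤ (B + 1) * (1 / (10 * (B + 1))) := by gcongr; linarith
      _ = 1 / 10 := by field_simp
  have hsumM : ∑ i, 2 * M i * ‖b (e i)‖ < 1 := by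
    have : ∑ i, 2 * M i * ‖b (e i)‖ = 2 * ∑ i, (M i : ℝ) * ‖b (e i)‖ := by
      rw [Finset.mul_sum]; exact Finset.sum_congr rfl fun i _ => by ring
    rw [this]; linarith
  have key := fun (N : Fin r → ℕ) hN => isProperCosetProg_of_injOn (phaseKernel T)
    (fun i => a (e i)) N fun h hh h' hh' n n' hn hn' =>
      phaseKernel_box_injective (fun i => hab (e i)) (fun i => hb (e i)) hbC' N hN hh hh'
        n n' hn hn'
  obtain ⟨hproper, hcard⟩ := key N hsumN
  obtain ⟨-, hcardM⟩ := key M hsumM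
  refine ⟨r, phaseKernel T, _, hrB, ⟨rfl, fun i => rfl⟩, hproper, ?_, ?_⟩
  · intro g hg
    obtain ⟨v, hv, hvn⟩ := mem_bohrSet.mp hg
    obtain ⟨n, hn⟩ := hgen g v hv (hvn.trans hρδ)
    have hbound : ∀ i, |(n i : ℝ)| * ‖b i‖ ≤ C * ρ := fun i => by
      refine (hbC n i).trans ?_
      rw [← hn]; gcongr
    have hsum : ∑ i, n (e i) • b (e i) = v := by
      rw [hn]
      refine Fintype.sum_of_injective e e.injective _ _ (fun i hi => ?_) (fun i => rfl)
      have h1 : n i = 0 := by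
        by_contra hne
        refine hi (hrange i ?_)
        have h2 : (1 : ℝ) ≤ |(n i : ℝ)| := by exact_mod_cast Int.one_le_abs hne
        nlinarith [hbound i, hb i]
      simp [h1]
    refine ⟨g - ∑ i, n (e i) • a (e i), ?_, ∑ i, n (e i) • a (e i), ?_, sub_add_cancel _ _⟩
    · have h1 := hv.sub (IsPhaseLift.sum Finset.univ fun i => (hab (e i)).zsmul (n (e i)))
      rw [hsum, sub_self] at h1
      exact h1
    · refine ⟨fun i => n (e i), fun i => ?_, by simp⟩
      rw [← abs_le]
      have h1 : |(n (e i) : ℝ)| ≤ C * ρ / ‖b (e i)‖ := by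
        rw [le_div_iff₀ (hb _)]; exact hbound (e i)
      have h2 : ((n (e i)).natAbs : ℝ) ≤ C * ρ / ‖b (e i)‖ := by
        rw [Nat.cast_natAbs]; exact_mod_cast h1
      have h3 := Nat.le_floor h2
      rw [Int.abs_eq_natAbs]
      exact_mod_cast h3
  · have hsub : (phaseKernel T : Set G).ncard * ∏ i, (2 * M i + 1) ≤
        (bohrSet T (1 / 10)).card := by
      rw [← hcardM, ← Set.ncard_coe_finset]
      refine Set.ncard_le_ncard ?_ (Set.toFinite _)
      rintro _ ⟨h, hh, _, ⟨n, hn, rfl⟩, rfl⟩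
      refine Finset.mem_coe.mpr (mem_bohrSet.mpr ⟨0 + ∑ i, n i • b (e i), ?_, ?_⟩)
      · rw [zero_add]
        have h1 := IsPhaseLift.add (mem_phaseKernel.mp hh)
          (IsPhaseLift.sum Finset.univ fun i => (hab (e i)).zsmul (n i))
        simpa using h1
      · rw [zero_add]
        refine ((norm_sum_zsmul_le _ _).trans (Finset.sum_le_sum fun i _ => ?_)).trans hsumM'
        refine mul_le_mul_of_nonneg_right ?_ (norm_nonneg _)
        exact_mod_cast abs_le.mpr (hn i)
    have hsub' : ((phaseKernel T : Set G).ncard : ℝ) * ∏ i, (2 * (M i : ℝ) + 1) ≤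
        (bohrSet T (1 / 10)).card := by exact_mod_cast hsub
    rw [hcard]
    push_cast
    have hfac : ∀ i, 2 * (N i : ℝ) + 1 ≤ (30 * C * (B + 1) * ρ) * (2 * (M i : ℝ) + 1) := by
      intro i
      have hbi := hb (e i)
      have h1 : (1 : ℝ) ≤ C * ρ / ‖b (e i)‖ := by
        rw [le_div_iff₀ hbi, one_mul]; exact heS i
      have h2 : (N i : ℝ) ≤ C * ρ / ‖b (e i)‖ := by rw [le_div_iff₀ hbi]; exact hN1 i
      have h3 := (Nat.lt_floor_add_one (1 / (10 * (B + 1) * ‖b (e i)‖))).le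
      have h4 : 1 / (10 * (B + 1) * ‖b (e i)‖) ≤ 2 * (M i : ℝ) + 1 :=
        h3.trans (by simp only [hMdef]; linarith [(M i).cast_nonneg (α := ℝ)])
      calc 2 * (N i : ℝ) + 1 ≤ 3 * (C * ρ / ‖b (e i)‖) := by linarith
        _ = (30 * C * (B + 1) * ρ) * (1 / (10 * (B + 1) * ‖b (e i)‖)) := by
          have : (B + 1) ≠ 0 := by positivity
          field_simp; norm_num
        _ ≤ _ := by gcongr
    have h30 : 1 ≤ 30 * C * (B + 1) := by nlinarith
    calc ((phaseKernel T : Set G).ncard : ℝ) * ∏ i, (2 * (N i : ℝ) + 1)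
        ≤ (phaseKernel T : Set G).ncard *
            ∏ i, (30 * C * (B + 1) * ρ) * (2 * (M i : ℝ) + 1) := by
          gcongr with i; exact hfac i
      _ = (30 * C * (B + 1)) ^ r * ρ ^ r *
          ((phaseKernel T : Set G).ncard * ∏ i, (2 * (M i : ℝ) + 1)) := by
          rw [Finset.prod_mul_distrib, Finset.prod_const, Finset.card_univ, Fintype.card_fin,
            mul_pow]
          ring
      _ ≤ (30 * C * (B + 1)) ^ ⌊B⌋₊ * ρ ^ r * (bohrSet T (1 / 10)).card := by
          have h5 : r ≤ ⌊B⌋₊ := (Nat.le_floor_iff hB).mpr hrB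
          gcongr

end Progression

section CharSum

variable {G : Type*} [AddCommGroup G] {ι : Type*} [Fintype ι]

/-- The real part of the sum of the values of a character along a family. -/
noncomputable def charSum (a : ι → G) (χ : AddChar G ℂ) : ℝ := ∑ i, (χ (a i)).re

theorem addChar_re_neg [Finite G] (χ : AddChar G ℂ) (g : G) : (χ (-g)).re = (χ g).re := by
  rw [AddChar.map_neg_eq_conj, Complex.conj_re]

theorem addChar_abs_re_le_one [Finite G] (χ : AddChar G ℂ) (g : G) : |(χ g).re| ≤ 1 := by
  rw [← AddChar.norm_apply χ g]; exact Complex.abs_re_le_norm _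

theorem abs_charSum_le [Finite G] (a : ι → G) (χ : AddChar G ℂ) :
    |charSum a χ| ≤ Fintype.card ι := by
  refine (Finset.abs_sum_le_sum_abs _ _).trans ?_
  refine (Finset.sum_le_sum fun i _ => addChar_abs_re_le_one χ (a i)).trans ?_
  simp

theorem ofReal_charSum [Finite G] {a : ι → G} (σ : Equiv.Perm ι) (hσ : ∀ i, a (σ i) = -a i)
    (χ : AddChar G ℂ) : (charSum a χ : ℂ) = ∑ i, χ (a i) := by
  apply Complex.ext
  · simp [charSum]
  · have h1 : ∑ i, (χ (a i)).im = ∑ i, (χ (a (σ i))).im :=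
      (Equiv.sum_comp σ fun i => (χ (a i)).im).symm
    have h2 : ∀ i, (χ (a (σ i))).im = -(χ (a i)).im := fun i => by
      rw [hσ, AddChar.map_neg_eq_conj, Complex.conj_im]
    simp only [h2, Finset.sum_neg_distrib] at h1
    simp only [Complex.ofReal_im, Complex.im_sum]
    linarith

/-- Fourier inversion for the number of representations of `g` as a sum of `m` members of a
symmetric family. -/
theorem sum_charSum_pow_mul_re [Fintype G] [DecidableEq G] {a : ι → G} (σ : Equiv.Perm ι)
    (hσ : ∀ i, a (σ i) = -a i) (m : ℕ) (g : G) :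
    ∑ χ : AddChar G ℂ, charSum a χ ^ m * (χ g).re =
      Fintype.card G * (Finset.univ.filter fun f : Fin m → ι => ∑ j, a (f j) = g).card := by
  have h1 : ∑ χ : AddChar G ℂ, (charSum a χ : ℂ) ^ m * χ (-g) =
      Fintype.card G * (Finset.univ.filter fun f : Fin m → ι => ∑ j, a (f j) = g).card := by
    have h2 : ∀ χ : AddChar G ℂ, (charSum a χ : ℂ) ^ m * χ (-g) =
        ∑ f : Fin m → ι, χ (∑ j, a (f j) - g) := fun χ => by
      rw [ofReal_charSum σ hσ, Fintype.sum_pow, Finset.sum_mul]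
      refine Finset.sum_congr rfl fun f _ => ?_
      rw [sub_eq_add_neg, AddChar.map_add_eq_mul]
      congr 1
      exact (map_prod χ.toMonoidHom (fun j => Multiplicative.ofAdd (a (f j))) Finset.univ).symm
    simp only [h2]
    rw [Finset.sum_comm]
    simp only [AddChar.sum_apply_eq_ite, sub_eq_zero]
    rw [Finset.sum_ite, Finset.sum_const_zero, add_zero, Finset.sum_const, nsmul_eq_mul, mul_comm]
  have h3 := congrArg Complex.re h1
  rw [Complex.re_sum] at h3
  have h4 : ((Fintype.card G : ℂ) *
      ((Finset.univ.filter fun f : Fin m → ι => ∑ j, a (f j) = g).card : ℂ)).re =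
      Fintype.card G * (Finset.univ.filter fun f : Fin m → ι => ∑ j, a (f j) = g).card := by
    rw [← Nat.cast_mul, Complex.natCast_re, Nat.cast_mul]
  rw [h4] at h3
  rw [← h3]
  refine Finset.sum_congr rfl fun χ _ => ?_
  rw [← Complex.ofReal_pow, Complex.re_ofReal_mul, addChar_re_neg]

theorem norm_sub_addChar_sq [Finite G] (χ : AddChar G ℂ) (g : G) (θ : ℝ) (hθ : θ ^ 2 = 1) :
    ‖(θ : ℂ) - χ g‖ ^ 2 = 2 - 2 * (θ * (χ g).re) := by
  have h1 : ‖χ g‖ ^ 2 = 1 := by rw [AddChar.norm_apply]; norm_num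
  rw [Complex.sq_norm, Complex.normSq_apply] at h1 ⊢
  simp only [Complex.sub_re, Complex.sub_im, Complex.ofReal_re, Complex.ofReal_im]
  nlinarith

theorem norm_add_sq_le_two_mul {E : Type*} [SeminormedAddCommGroup E] (u v : E) :
    ‖u + v‖ ^ 2 ≤ 2 * ‖u‖ ^ 2 + 2 * ‖v‖ ^ 2 := by
  have h1 := norm_add_le u v
  have h2 := norm_nonneg (u + v)
  nlinarith [sq_nonneg (‖u‖ - ‖v‖)]

/-- A character which is strongly biased on `Y` is close to one at all almost-periods of `Y`. -/
theorem norm_one_sub_addChar_sq_le [Finite G] [DecidableEq G] {Y : Finset G} (hY : Y.Nonempty)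
    {χ : AddChar G ℂ} {η : ℝ} (hχ : (1 - η) * Y.card ≤ |charSum (fun y : Y => (y : G)) χ|) {z : G}
    (hz : Y.card ≤ 2 * (Y.filter fun y => y + z ∈ Y).card) : ‖1 - χ z‖ ^ 2 ≤ 16 * η := by
  obtain ⟨θ, hθ, hθ2⟩ : ∃ θ : ℝ, θ ^ 2 = 1 ∧
      θ * charSum (fun y : Y => (y : G)) χ = |charSum (fun y : Y => (y : G)) χ| := by
    rcases abs_cases (charSum (fun y : Y => (y : G)) χ) with ⟨h, -⟩ | ⟨h, -⟩
    · exact ⟨1, by norm_num, by rw [h, one_mul]⟩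
    · exact ⟨-1, by norm_num, by rw [h]; ring⟩
  have htot : ∑ y ∈ Y, ‖(θ : ℂ) - χ y‖ ^ 2 ≤ 2 * η * Y.card := by
    have h1 : ∑ y ∈ Y, ‖(θ : ℂ) - χ y‖ ^ 2 =
        2 * Y.card - 2 * (θ * charSum (fun y : Y => (y : G)) χ) := by
      rw [charSum, Finset.sum_coe_sort Y fun y => (χ y).re]
      simp only [norm_sub_addChar_sq _ _ _ hθ, Finset.sum_sub_distrib, Finset.sum_const,
        nsmul_eq_mul, Finset.mul_sum]
      ring
    rw [h1, hθ2]; linarith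
  set Y' := Y.filter fun y => y + z ∈ Y with hY'
  have hpt : ∀ y ∈ Y', ‖1 - χ z‖ ^ 2 ≤
      2 * ‖(θ : ℂ) - χ (y + z)‖ ^ 2 + 2 * ‖(θ : ℂ) - χ y‖ ^ 2 := by
    intro y _
    have h1 : ‖1 - χ z‖ = ‖((θ : ℂ) - χ (y + z)) + -((θ : ℂ) - χ y)‖ := by
      have h2 : ((θ : ℂ) - χ (y + z)) + -((θ : ℂ) - χ y) = χ y * (1 - χ z) := by
        rw [AddChar.map_add_eq_mul]; ring
      rw [h2, norm_mul, AddChar.norm_apply, one_mul]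
    rw [h1]
    refine (norm_add_sq_le_two_mul _ _).trans ?_
    rw [norm_neg]
  have h1 := Finset.sum_le_sum hpt
  rw [Finset.sum_const, nsmul_eq_mul, Finset.sum_add_distrib, ← Finset.mul_sum,
    ← Finset.mul_sum] at h1
  have h2 : ∑ y ∈ Y', ‖(θ : ℂ) - χ y‖ ^ 2 ≤ ∑ y ∈ Y, ‖(θ : ℂ) - χ y‖ ^ 2 :=
    Finset.sum_le_sum_of_subset_of_nonneg (Finset.filter_subset _ _) fun _ _ _ => sq_nonneg _
  have h3 : ∑ y ∈ Y', ‖(θ : ℂ) - χ (y + z)‖ ^ 2 ≤ ∑ y ∈ Y, ‖(θ : ℂ) - χ y‖ ^ 2 := by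
    rw [← Finset.sum_image (f := fun y => ‖(θ : ℂ) - χ y‖ ^ 2) (g := fun y => y + z)
      (fun _ _ _ _ h => add_right_cancel h)]
    refine Finset.sum_le_sum_of_subset_of_nonneg ?_ fun _ _ _ => sq_nonneg _
    intro y hy
    obtain ⟨x, hx, rfl⟩ := Finset.mem_image.mp hy
    exact (Finset.mem_filter.mp hx).2
  have h4 : (Y.card : ℝ) ≤ 2 * Y'.card := by exact_mod_cast hz
  have h5 : (0 : ℝ) < Y.card := by exact_mod_cast hY.card_pos
  have h6 := mul_le_mul_of_nonneg_right h4 (sq_nonneg ‖1 - χ z‖)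
  by_contra! h7
  nlinarith

/-- An element at which all strongly biased characters of `Y` are close to one is a sum of boundedly
many elements of `Y`. -/
theorem mem_of_forall_biased [Fintype G] {Y W : Finset G} (hY : Y.Nonempty)
    (hneg : ∀ y ∈ Y, -y ∈ Y) {η : ℝ} (hη1 : η ≤ 1) (s : ℕ)
    (hW : ∀ f : Fin (2 * (s + 1)) → Y, ∑ j, (f j : G) ∈ W)
    (hcard : 3 * (1 - η) ^ (2 * s) * W.card < Y.card) {g : G}
    (hg : ∀ χ : AddChar G ℂ, (1 - η) * Y.card ≤ |charSum (fun y : Y => (y : G)) χ| →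
      1 / 2 ≤ (χ g).re) : g ∈ W := by
  classical
  by_contra hgW
  set a : Y → G := fun y => (y : G) with ha
  let σ : Equiv.Perm Y := ⟨fun y => ⟨-y, hneg y y.2⟩, fun y => ⟨-y, hneg y y.2⟩,
    fun y => by simp, fun y => by simp⟩
  have hσ : ∀ i, a (σ i) = -a i := fun i => rfl
  have hpow := fun m g => sum_charSum_pow_mul_re (a := a) σ hσ m g
  set P : ℝ := ∑ χ : AddChar G ℂ, charSum a χ ^ (2 * (s + 1)) with hP
  set cnt : G → ℕ := fun h =>
    (Finset.univ.filter fun f : Fin (2 * (s + 1)) → Y => ∑ j, a (f j) = h).card with hcnt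
  have hcnt0 : ∀ h, h ∉ W → cnt h = 0 := by
    intro h hh
    rw [hcnt, Finset.card_eq_zero, Finset.filter_eq_empty_iff]
    rintro f - rfl
    exact hh (hW f)
  have hpospow : ∀ χ : AddChar G ℂ, 0 ≤ charSum a χ ^ (2 * (s + 1)) := fun χ =>
    (even_two_mul _).pow_nonneg _
  have hcntP : ∀ h, (Fintype.card G : ℝ) * cnt h ≤ P := by
    intro h
    rw [← hpow]
    refine Finset.sum_le_sum fun χ _ => ?_
    exact mul_le_of_le_one_right (hpospow χ) ((le_abs_self _).trans (addChar_abs_re_le_one χ h))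
  have htotal : ∑ h ∈ W, cnt h = Y.card ^ (2 * (s + 1)) := by
    have h1 := Finset.card_eq_sum_card_fiberwise (s := Finset.univ) (t := W)
      (f := fun f : Fin (2 * (s + 1)) → Y => ∑ j, a (f j)) fun f _ => hW f
    rw [← h1]; simp
  have hlow : (Fintype.card G : ℝ) * Y.card ^ (2 * (s + 1)) ≤ W.card * P := by
    have h1 : ((∑ h ∈ W, cnt h : ℕ) : ℝ) = (Y.card : ℝ) ^ (2 * (s + 1)) := by
      rw [htotal]; push_cast; rfl
    rw [← h1, Nat.cast_sum, Finset.mul_sum]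
    refine (Finset.sum_le_sum fun h _ => hcntP h).trans ?_
    simp
  have hparseval : ∑ χ : AddChar G ℂ, charSum a χ ^ 2 ≤ Fintype.card G * Y.card := by
    have h1 := hpow 2 0
    simp only [AddChar.map_zero_eq_one, Complex.one_re, mul_one] at h1
    rw [h1]
    gcongr
    rw [← Fintype.card_coe Y, ← Finset.card_univ]
    refine Finset.card_le_card_of_injOn (fun f => f 0) (fun _ _ => by simp) ?_
    intro f hf f' hf' heq
    simp only [Finset.coe_filter, Finset.mem_univ, true_and, Fin.sum_univ_two] at hf hf'
    have h2 : a (f 0) + a (f 1) = 0 := hf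
    have h3 : a (f' 0) + a (f' 1) = 0 := hf'
    have heq' : f 0 = f' 0 := heq
    have h4 : a (f 1) = a (f' 1) := by
      rw [heq'] at h2
      exact add_left_cancel (h2.trans h3.symm)
    funext i
    fin_cases i
    · exact heq'
    · exact Subtype.ext h4
  have hY0 : (0 : ℝ) < Y.card := by exact_mod_cast hY.card_pos
  have hη0 : 0 ≤ (1 - η) * Y.card := mul_nonneg (by linarith) hY0.le
  have hpt : ∀ χ : AddChar G ℂ, 1 / 2 * charSum a χ ^ (2 * (s + 1)) -
      3 / 2 * (((1 - η) * Y.card) ^ (2 * s) * charSum a χ ^ 2) ≤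
      charSum a χ ^ (2 * (s + 1)) * (χ g).re := by
    intro χ
    have h0 := hpospow χ
    have h1 : 0 ≤ ((1 - η) * Y.card) ^ (2 * s) * charSum a χ ^ 2 := by positivity
    by_cases hχ : (1 - η) * Y.card ≤ |charSum a χ|
    · have h2 := hg χ hχ
      nlinarith
    · have h2 : charSum a χ ^ (2 * (s + 1)) ≤ ((1 - η) * Y.card) ^ (2 * s) * charSum a χ ^ 2 := by
        rw [show 2 * (s + 1) = 2 * s + 2 by ring, pow_add]
        refine mul_le_mul_of_nonneg_right ?_ (sq_nonneg _)
        rw [← (even_two_mul s).pow_abs (charSum a χ)]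
        exact pow_le_pow_left₀ (abs_nonneg _) (le_of_not_ge hχ) _
      have h3 := (abs_le.mp (addChar_abs_re_le_one χ g)).1
      nlinarith
  have h1 := Finset.sum_le_sum fun χ (_ : χ ∈ Finset.univ) => hpt χ
  rw [hpow, Finset.sum_sub_distrib, ← Finset.mul_sum, ← Finset.mul_sum, ← Finset.mul_sum] at h1
  have h2 : (Finset.univ.filter fun f : Fin (2 * (s + 1)) → Y => ∑ j, a (f j) = g).card = 0 :=
    hcnt0 g hgW
  rw [h2, Nat.cast_zero, mul_zero, ← hP] at h1
  have h3 : ((1 - η) * Y.card) ^ (2 * s) * ∑ χ : AddChar G ℂ, charSum a χ ^ 2 ≤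
      ((1 - η) * Y.card) ^ (2 * s) * (Fintype.card G * Y.card) := by gcongr
  have h4 : P ≤ 3 * (((1 - η) * Y.card) ^ (2 * s) * (Fintype.card G * Y.card)) := by linarith
  have h5 := mul_le_mul_of_nonneg_left h4 (Nat.cast_nonneg (α := ℝ) W.card)
  have h6 : (0 : ℝ) < Fintype.card G * Y.card ^ (2 * s + 1) := by positivity
  have h7 := mul_lt_mul_of_pos_left hcard h6
  have h8 : (W.card : ℝ) * (3 * (((1 - η) * Y.card) ^ (2 * s) * (Fintype.card G * Y.card))) =
      Fintype.card G * Y.card ^ (2 * s + 1) * (3 * (1 - η) ^ (2 * s) * W.card) := by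
    rw [mul_pow]; ring
  have h9 : (Fintype.card G : ℝ) * Y.card ^ (2 * (s + 1)) =
      Fintype.card G * Y.card ^ (2 * s + 1) * Y.card := by ring
  linarith

end CharSum

theorem abs_le_of_norm_one_sub_exp {v : ℝ} (hv : |v| ≤ 1 / 2)
    (h : ‖1 - Complex.exp ((v : ℂ) * (2 * Real.pi * Complex.I))‖ ^ 2 ≤ 16 * (1 / 400)) :
    |v| ≤ 1 / 20 := by
  have h1 : (v : ℂ) * (2 * Real.pi * Complex.I) = ((2 * Real.pi * v : ℝ) : ℂ) * Complex.I := by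
    push_cast; ring
  rw [h1, Complex.sq_norm, Complex.normSq_apply] at h
  simp only [Complex.sub_re, Complex.sub_im, Complex.one_re, Complex.one_im,
    Complex.exp_ofReal_mul_I_re, Complex.exp_ofReal_mul_I_im] at h
  have h2 : |2 * Real.pi * v| ≤ Real.pi := by
    rw [abs_mul, abs_of_pos (by positivity : 0 < 2 * Real.pi)]
    nlinarith [Real.pi_pos]
  have h4 := Real.cos_le_one_sub_mul_cos_sq h2
  have h5 : 2 / Real.pi ^ 2 * (2 * Real.pi * v) ^ 2 = 8 * v ^ 2 := by
    field_simp; ring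
  have h6 := Real.sin_sq_add_cos_sq (2 * Real.pi * v)
  have h7 : v ^ 2 ≤ (1 / 20) ^ 2 := by nlinarith
  exact abs_le_of_sq_le_sq h7 (by norm_num)

theorem half_le_re_exp {v : ℝ} (hv : |v| ≤ 1 / 10) :
    1 / 2 ≤ (Complex.exp ((v : ℂ) * (2 * Real.pi * Complex.I))).re := by
  have h1 : (v : ℂ) * (2 * Real.pi * Complex.I) = ((2 * Real.pi * v : ℝ) : ℂ) * Complex.I := by
    push_cast; ring
  rw [h1, Complex.exp_ofReal_mul_I_re, ← Real.cos_pi_div_three, ← Real.cos_abs (2 * Real.pi * v)]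
  have := Real.pi_pos
  apply Real.cos_le_cos_of_nonneg_of_le_pi (abs_nonneg _) (by linarith)
  rw [abs_mul, abs_of_pos (by positivity : 0 < 2 * Real.pi)]
  nlinarith

section SumBall

variable {G : Type*} [AddCommGroup G]

open Classical in
/-- The set of sums of `i` elements of `X`. -/
noncomputable def sumBall (X : Finset G) : ℕ → Finset G
  | 0 => {0}
  | i + 1 => sumBall X i + X

variable {X : Finset G}

theorem mem_sumBall_zero {g : G} : g ∈ sumBall X 0 ↔ g = 0 := by
  simp [sumBall]

theorem mem_sumBall_succ {i : ℕ} {g : G} :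
    g ∈ sumBall X (i + 1) ↔ ∃ h ∈ sumBall X i, ∃ x ∈ X, h + x = g := by
  classical
  rw [sumBall, Finset.mem_add]

theorem sumBall_mono (h0 : 0 ∈ X) : Monotone (sumBall X) := by
  refine monotone_nat_of_le_succ fun i g hg => ?_
  exact mem_sumBall_succ.mpr ⟨g, hg, 0, h0, add_zero g⟩

theorem zero_mem_sumBall (h0 : 0 ∈ X) (i : ℕ) : 0 ∈ sumBall X i :=
  sumBall_mono h0 (Nat.zero_le i) (mem_sumBall_zero.mpr rfl)

theorem neg_mem_sumBall (hneg : ∀ x ∈ X, -x ∈ X) {i : ℕ} {g : G} (hg : g ∈ sumBall X i) :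
    -g ∈ sumBall X i := by
  induction i generalizing g with
  | zero => rw [mem_sumBall_zero] at hg ⊢; rw [hg, neg_zero]
  | succ i ih =>
    obtain ⟨h, hh, x, hx, rfl⟩ := mem_sumBall_succ.mp hg
    exact mem_sumBall_succ.mpr ⟨-h, ih hh, -x, hneg x hx, (neg_add h x).symm⟩

theorem add_mem_sumBall {i j : ℕ} {g h : G} (hg : g ∈ sumBall X i) (hh : h ∈ sumBall X j) :
    g + h ∈ sumBall X (i + j) := by
  induction j generalizing h with
  | zero => rw [mem_sumBall_zero] at hh; simpa [hh] using hg
  | succ j ih =>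
    obtain ⟨k, hk, x, hx, rfl⟩ := mem_sumBall_succ.mp hh
    exact mem_sumBall_succ.mpr ⟨g + k, ih hk, x, hx, add_assoc g k x⟩

theorem nsmul_mem_sumBall {x : G} (hx : x ∈ X) (i : ℕ) : i • x ∈ sumBall X i := by
  induction i with
  | zero => rw [mem_sumBall_zero, zero_smul]
  | succ i ih => exact mem_sumBall_succ.mpr ⟨i • x, ih, x, hx, (succ_nsmul x i).symm⟩

theorem sum_mem_sumBall {y n : ℕ} {f : Fin n → G} (hf : ∀ i, f i ∈ sumBall X y) :
    ∑ i, f i ∈ sumBall X (n * y) := by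
  induction n with
  | zero => simp [mem_sumBall_zero]
  | succ n ih =>
    rw [Fin.sum_univ_castSucc, Nat.succ_mul]
    exact add_mem_sumBall (ih fun i => hf _) (hf _)

theorem card_sumBall_pos (h0 : 0 ∈ X) (i : ℕ) : 0 < (sumBall X i).card :=
  Finset.card_pos.mpr ⟨0, zero_mem_sumBall h0 i⟩

theorem card_le_two_mul_card_filter_add_mem [DecidableEq G] {y l : ℕ} (h0 : 0 ∈ X)
    (hneg : ∀ x ∈ X, -x ∈ X)
    (h : 2 * (sumBall X (y + l)).card ≤ 3 * (sumBall X y).card) {z : G} (hz : z ∈ sumBall X l) :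
    (sumBall X y).card ≤ 2 * ((sumBall X y).filter fun g => g + z ∈ sumBall X y).card := by
  set Y := sumBall X y with hY
  have h1 : (Y.image fun g => g - z).card = Y.card :=
    Finset.card_image_of_injective _ (sub_left_injective)
  have h2 : (Y.filter fun g => g + z ∈ Y) = Y ∩ Y.image fun g => g - z := by
    ext g
    simp only [Finset.mem_filter, Finset.mem_inter, Finset.mem_image, and_congr_right_iff]
    intro _
    constructor
    · exact fun hg => ⟨g + z, hg, add_sub_cancel_right g z⟩
    · rintro ⟨k, hk, rfl⟩
      rwa [sub_add_cancel]
  have h3 : (Y ∪ Y.image fun g => g - z).card ≤ (sumBall X (y + l)).card := by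
    refine Finset.card_le_card (Finset.union_subset (sumBall_mono h0 (Nat.le_add_right y l)) ?_)
    intro g hg
    obtain ⟨k, hk, rfl⟩ := Finset.mem_image.mp hg
    rw [sub_eq_add_neg]
    exact add_mem_sumBall hk (neg_mem_sumBall hneg hz)
  have h4 := Finset.card_union_add_card_inter Y (Y.image fun g => g - z)
  rw [h2]
  omega

theorem mul_abs_le_of_forall_norm_one_sub_exp {v : ℝ} (hv : |v| ≤ 1 / 2) (l : ℕ)
    (h : ∀ i : ℕ, 1 ≤ i → i ≤ l →
      ‖1 - Complex.exp (((i * v : ℝ) : ℂ) * (2 * Real.pi * Complex.I))‖ ^ 2 ≤ 16 * (1 / 400)) :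
    l * |v| ≤ 1 / 20 := by
  have key : ∀ i : ℕ, i ≤ l → i * |v| ≤ 1 / 20 := by
    intro i
    induction i with
    | zero => intro _; norm_num
    | succ i ih =>
      intro hi
      have h1 := ih (by omega)
      have h2 : |((i + 1 : ℕ) : ℝ) * v| = ((i + 1 : ℕ) : ℝ) * |v| := by
        rw [abs_mul, Nat.abs_cast]
      rw [← h2]
      refine abs_le_of_norm_one_sub_exp ?_ (h (i + 1) (by omega) hi)
      rw [h2]
      rcases Nat.eq_zero_or_pos i with rfl | hi0
      · simpa using hv
      · have h3 : (1 : ℝ) ≤ i := by exact_mod_cast hi0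
        push_cast
        nlinarith [abs_nonneg v]
  exact key l le_rfl

theorem exists_nat_mul_pow_mul_rpow_lt (B : ℝ) (hB : 0 ≤ B) {c : ℝ} (hc0 : 0 ≤ c) (hc1 : c < 1) :
    ∃ s : ℕ, 3 * c ^ (2 * s) * (8 * ((s : ℝ) + 1)) ^ B < 1 := by
  have h1 := tendsto_pow_const_mul_const_pow_of_abs_lt_one ⌈B⌉₊
    (r := c ^ 2) (by rw [abs_of_nonneg (by positivity)]; nlinarith)
  have h2 : (0 : ℝ) < 1 / (3 * 16 ^ ⌈B⌉₊) := by positivity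
  obtain ⟨s, hs, hs1⟩ := ((h1.eventually (gt_mem_nhds h2)).and
    (Filter.eventually_ge_atTop 1)).exists
  refine ⟨s, ?_⟩
  have h3 : (1 : ℝ) ≤ s := by exact_mod_cast hs1
  have h4 : (8 * ((s : ℝ) + 1)) ^ B ≤ (16 * s) ^ ⌈B⌉₊ := by
    rw [← Real.rpow_natCast]
    calc (8 * ((s : ℝ) + 1)) ^ B ≤ (16 * s) ^ B :=
          Real.rpow_le_rpow (by positivity) (by linarith) hB
      _ ≤ _ := Real.rpow_le_rpow_of_exponent_le (by linarith) (Nat.le_ceil B)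
  rw [lt_div_iff₀ (by positivity)] at hs
  calc 3 * c ^ (2 * s) * (8 * ((s : ℝ) + 1)) ^ B ≤ 3 * c ^ (2 * s) * (16 * s) ^ ⌈B⌉₊ := by gcongr
    _ = s ^ ⌈B⌉₊ * (c ^ 2) ^ s * (3 * 16 ^ ⌈B⌉₊) := by rw [mul_pow, pow_mul]; ring
    _ < 1 := hs

theorem exists_bohrSet_between (B : ℝ) (hB : 0 ≤ B) : ∃ c : ℕ, 0 < c ∧
    ∀ {G : Type*} [AddCommGroup G] [Fintype G] (X : Finset G), 0 ∈ X → (∀ x ∈ X, -x ∈ X) →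
      ∀ J : ℕ, c ≤ J →
      (∀ i : ℕ, 1 ≤ i → i ≤ J →
        ((i : ℝ) / J) ^ B * (sumBall X J).card ≤ (sumBall X i).card) →
      ∃ T : Finset (AddChar G ℂ), X ⊆ bohrSet T (1 / (20 * (J / c : ℕ))) ∧
        bohrSet T (1 / 10) ⊆ sumBall X J := by
  obtain ⟨s, hs⟩ := exists_nat_mul_pow_mul_rpow_lt B hB (c := 1 - 1 / 400) (by norm_num)
    (by norm_num)
  obtain ⟨q, hq⟩ := pow_unbounded_of_one_lt ((8 * ((s : ℝ) + 1)) ^ B) (y := 3 / 2) (by norm_num)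
  have hq0 : 0 < q := by
    rcases Nat.eq_zero_or_pos q with rfl | h
    · have : (1 : ℝ) ≤ (8 * ((s : ℝ) + 1)) ^ B :=
        Real.one_le_rpow (by linarith [s.cast_nonneg (α := ℝ)]) hB
      rw [pow_zero] at hq
      linarith
    · exact h
  refine ⟨4 * (s + 1) * q, by positivity, ?_⟩
  intro G _ _ X h0 hneg J hJ hgrow
  classical
  set c := 4 * (s + 1) * q with hc
  have hc0 : 0 < c := by positivity
  set l := J / c with hl
  have hl1 : 1 ≤ l := (Nat.one_le_div_iff hc0).mpr hJ
  have hlJ : c * l ≤ J := Nat.mul_div_le J c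
  have hJl : J ≤ 2 * c * l := by
    have := Nat.lt_mul_div_succ J hc0
    rw [← hl] at this
    nlinarith
  have hJ0 : (0 : ℝ) < J := by exact_mod_cast lt_of_lt_of_le hc0 hJ
  have hcard : ∀ y, q * l ≤ y → y ≤ J →
      ((sumBall X J).card : ℝ) ≤ (8 * ((s : ℝ) + 1)) ^ B * (sumBall X y).card := by
    intro y hy hyJ
    have hy1 : 1 ≤ y := le_trans (Nat.mul_pos hq0 hl1) hy
    have h1 := hgrow y hy1 hyJ
    have h2 : J ≤ 8 * (s + 1) * y := by
      calc J ≤ 2 * c * l := hJl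
        _ = 8 * (s + 1) * (q * l) := by rw [hc]; ring
        _ ≤ _ := by gcongr
    have h3 : (J : ℝ) ≤ 8 * (s + 1) * y := by exact_mod_cast h2
    have h4 : 1 ≤ (8 * ((s : ℝ) + 1)) * (y / J) := by
      rw [← mul_div_assoc, one_le_div hJ0]; exact h3
    have h5 : 1 ≤ (8 * ((s : ℝ) + 1)) ^ B * (y / J) ^ B := by
      rw [← Real.mul_rpow (by positivity) (by positivity)]
      exact Real.one_le_rpow h4 hB
    calc ((sumBall X J).card : ℝ) = 1 * (sumBall X J).card := (one_mul _).symm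
      _ ≤ (8 * ((s : ℝ) + 1)) ^ B * (y / J) ^ B * (sumBall X J).card := by gcongr
      _ ≤ _ := by rw [mul_assoc]; gcongr
  obtain ⟨i, hiq, hi⟩ : ∃ i < q, 2 * (sumBall X ((q + i) * l + l)).card ≤
      3 * (sumBall X ((q + i) * l)).card := by
    by_contra! hcon
    have key : ∀ i ≤ q, (3 / 2 : ℝ) ^ i * (sumBall X (q * l)).card ≤
        (sumBall X ((q + i) * l)).card := by
      intro i
      induction i with
      | zero => intro _; simp
      | succ i ih =>
        intro hi
        have h1 := ih (by omega)
        have h2 := hcon i (by omega)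
        have h3 : (3 : ℝ) * (sumBall X ((q + i) * l)).card <
            2 * (sumBall X ((q + i) * l + l)).card := by exact_mod_cast h2
        rw [show (q + (i + 1)) * l = (q + i) * l + l by ring, pow_succ]
        linarith
    have h1 := key q le_rfl
    have h2 : (q + q) * l ≤ J := by
      refine le_trans ?_ hlJ
      rw [hc]
      refine Nat.mul_le_mul_right l ?_
      nlinarith
    have h3 : ((sumBall X ((q + q) * l)).card : ℝ) ≤ (sumBall X J).card := by
      exact_mod_cast Finset.card_le_card (sumBall_mono h0 h2)
    have h4 := hcard (q * l) le_rfl (by nlinarith)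
    have h5 : (0 : ℝ) < (sumBall X (q * l)).card := by exact_mod_cast card_sumBall_pos h0 _
    have h6 := mul_lt_mul_of_pos_right hq h5
    linarith
  set y := (q + i) * l with hy
  set Y := sumBall X y with hY
  have hYne : Y.Nonempty := ⟨0, zero_mem_sumBall h0 y⟩
  have hqy : q * l ≤ y := by rw [hy]; gcongr; omega
  have hyJ : 2 * (s + 1) * y ≤ J := by
    refine le_trans ?_ hlJ
    calc 2 * (s + 1) * y ≤ 2 * (s + 1) * ((q + q) * l) := by rw [hy]; gcongr
      _ = c * l := by rw [hc]; ring
  refine ⟨Finset.univ.filter fun χ =>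
    (1 - 1 / 400) * (Y.card : ℝ) ≤ |charSum (fun y : Y => (y : G)) χ|, ?_, ?_⟩
  · intro x hx
    set T := Finset.univ.filter fun χ : AddChar G ℂ =>
      (1 - 1 / 400) * (Y.card : ℝ) ≤ |charSum (fun y : Y => (y : G)) χ| with hT
    obtain ⟨v, hv, hv2⟩ := exists_isPhaseLift T x
    refine mem_bohrSet.mpr ⟨v, hv, ?_⟩
    have hl0 : (0 : ℝ) < l := by exact_mod_cast hl1
    rw [pi_norm_le_iff_of_nonneg (by positivity)]
    intro χ
    rw [Real.norm_eq_abs, le_div_iff₀ (by positivity)]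
    have h1 := mul_abs_le_of_forall_norm_one_sub_exp (hv2 χ) l (fun j _ hj => by
      have h2 := hv.nsmul j χ
      have h3 : ((j • v) χ : ℝ) = j * v χ := by simp
      rw [h3] at h2
      rw [← h2]
      refine norm_one_sub_addChar_sq_le hYne (Finset.mem_filter.mp χ.2).2 ?_
      exact card_le_two_mul_card_filter_add_mem h0 hneg hi
        (sumBall_mono h0 hj (nsmul_mem_sumBall hx j)))
    linarith
  · intro g hg
    obtain ⟨v, hv, hv2⟩ := mem_bohrSet.mp hg
    refine mem_of_forall_biased (Y := Y) hYne (fun z hz => neg_mem_sumBall hneg hz)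
      (η := 1 / 400) (by norm_num) s (fun f => ?_) ?_ fun χ hχ => ?_
    · exact sumBall_mono h0 hyJ (sum_mem_sumBall fun j => (f j).2)
    · have h1 := hcard y hqy (by nlinarith)
      have h2 : (0 : ℝ) < Y.card := by exact_mod_cast hYne.card_pos
      calc 3 * (1 - 1 / 400 : ℝ) ^ (2 * s) * (sumBall X J).card
          ≤ 3 * (1 - 1 / 400 : ℝ) ^ (2 * s) * ((8 * ((s : ℝ) + 1)) ^ B * Y.card) := by gcongr
        _ = 3 * (1 - 1 / 400 : ℝ) ^ (2 * s) * (8 * ((s : ℝ) + 1)) ^ B * Y.card := by ring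
        _ < 1 * Y.card := by gcongr
        _ = Y.card := one_mul _
    · have h1 := hv ⟨χ, Finset.mem_filter.mpr ⟨Finset.mem_univ χ, hχ⟩⟩
      rw [h1]
      refine half_le_re_exp ((norm_le_pi_norm v _).trans hv2)

end SumBall

section LongRange

theorem mem_bohrSet_of_mem_sumBall {G : Type*} [AddCommGroup G] [Fintype G] {X : Finset G}
    {T : Finset (AddChar G ℂ)} {δ : ℝ} (hX : X ⊆ bohrSet T δ) {i : ℕ} {g : G}
    (hg : g ∈ sumBall X i) : g ∈ bohrSet T (i * δ) := by
  induction i generalizing g with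
  | zero =>
    rw [mem_sumBall_zero.mp hg]
    exact mem_bohrSet.mpr ⟨0, IsPhaseLift.zero, by simp⟩
  | succ i ih =>
    obtain ⟨h, hh, x, hx, rfl⟩ := mem_sumBall_succ.mp hg
    obtain ⟨v, hv, hv2⟩ := mem_bohrSet.mp (ih hh)
    obtain ⟨w, hw, hw2⟩ := mem_bohrSet.mp (hX hx)
    refine mem_bohrSet.mpr ⟨v + w, hv.add hw, (norm_add_le v w).trans ?_⟩
    push_cast
    linarith

/-- If the iterated sumsets of `X` grow polynomially at all scales up to `J`, then `X` lies in a
proper coset progression which is small compared to `sumBall X J`. -/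
theorem exists_cosetProg_of_growth (B : ℝ) (hB : 0 ≤ B) : ∃ J₀ : ℕ, ∃ K : ℝ, 0 < K ∧
    ∀ {G : Type*} [AddCommGroup G] [Fintype G] (X : Finset G), 0 ∈ X → (∀ x ∈ X, -x ∈ X) →
      ∀ J : ℕ, J₀ ≤ J →
      (∀ i : ℕ, 1 ≤ i → i ≤ J →
        ((i : ℝ) / J) ^ B * (sumBall X J).card ≤ (sumBall X i).card) →
      ∃ (r : ℕ) (H : AddSubgroup G) (Q : GAPData G r), (r : ℝ) ≤ B ∧ Q.IsSymmetric ∧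
        IsProperCosetProg H Q ∧ (∀ g ∈ X, g ∈ (H : Set G) + Q.toSet) ∧
        (((H : Set G) + Q.toSet).ncard : ℝ) * J ^ r ≤ K * (sumBall X J).card := by
  obtain ⟨c, hc, hbohr⟩ := exists_bohrSet_between B hB
  have hc' : (0 : ℝ) < c := by exact_mod_cast hc
  obtain ⟨δ, hδ, hδ1, ρ₀, hρ₀, K, hK, hprog⟩ := exists_cosetProg_of_bohrSet B (5 / c) hB
    (by positivity)
  refine ⟨c * (⌈1 / (20 * δ)⌉₊ + ⌈1 / (20 * ρ₀)⌉₊ + 1), K * (c + 1) ^ ⌊B⌋₊, by positivity, ?_⟩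
  intro G _ _ X h0 hneg J hJ hgrow
  have hl := (Nat.le_div_iff_mul_le hc).mpr ((mul_comm _ _).trans_le hJ)
  set l := J / c with hldef
  have hl1 : 1 ≤ l := by omega
  have hl0 : (0 : ℝ) < l := by exact_mod_cast hl1
  have hlJ : c * l ≤ J := Nat.mul_div_le J c
  have hJl : (J : ℝ) ≤ 2 * c * l := by
    have h1 := Nat.lt_mul_div_succ J hc
    rw [← hldef] at h1
    have h2 : J ≤ 2 * c * l := by nlinarith
    exact_mod_cast h2
  have hJc : c ≤ J := by nlinarith
  have hJ0 : (0 : ℝ) < J := by exact_mod_cast lt_of_lt_of_le hc hJc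
  have hlδ : 1 ≤ 20 * l * δ := by
    have h1 := Nat.le_ceil (1 / (20 * δ))
    have h2 : (⌈1 / (20 * δ)⌉₊ : ℝ) ≤ l := by exact_mod_cast (by omega)
    have h3 := h1.trans h2
    rw [div_le_iff₀ (by positivity)] at h3
    linarith
  have hlρ : 1 / (20 * (l : ℝ)) ≤ ρ₀ := by
    have h1 := Nat.le_ceil (1 / (20 * ρ₀))
    have h2 : (⌈1 / (20 * ρ₀)⌉₊ : ℝ) ≤ l := by exact_mod_cast (by omega)
    have h3 := h1.trans h2
    rw [div_le_iff₀ (by positivity)] at h3 ⊢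
    linarith
  obtain ⟨T, hXT, hTJ⟩ := hbohr X h0 hneg J hJc hgrow
  have hTJ' : ((bohrSet T (1 / 10)).card : ℝ) ≤ (sumBall X J).card := by
    exact_mod_cast Finset.card_le_card hTJ
  have hbohrgrow : (5 / c * δ) ^ B * ((bohrSet T (1 / 10)).card : ℝ) ≤ (bohrSet T δ).card := by
    set i := ⌊20 * l * δ⌋₊ with hi
    have hi1 : 1 ≤ i := (Nat.one_le_floor_iff _).mpr hlδ
    have hi2 : (i : ℝ) ≤ 20 * l * δ := Nat.floor_le (by positivity)
    have hi3 : 10 * l * δ ≤ i := by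
      have h1 := Nat.lt_floor_add_one (20 * l * δ)
      rw [← hi] at h1
      have h2 : (1 : ℝ) ≤ i := by exact_mod_cast hi1
      linarith
    have hiJ : i ≤ J := by
      have h1 : (i : ℝ) ≤ l := by nlinarith
      have h2 : i ≤ l := by exact_mod_cast h1
      nlinarith
    have h1 : 5 / c * δ ≤ i / J := by
      rw [le_div_iff₀ hJ0]
      calc 5 / c * δ * J ≤ 5 / c * δ * (2 * c * l) := by gcongr
        _ = 10 * l * δ := by field_simp; ring
        _ ≤ i := hi3
    have h2 : sumBall X i ⊆ bohrSet T δ := by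
      intro g hg
      obtain ⟨v, hv, hv2⟩ := mem_bohrSet.mp (mem_bohrSet_of_mem_sumBall hXT hg)
      refine mem_bohrSet.mpr ⟨v, hv, hv2.trans ?_⟩
      rw [mul_one_div, div_le_iff₀ (by positivity)]
      linarith
    have h3 : ((sumBall X i).card : ℝ) ≤ (bohrSet T δ).card := by
      exact_mod_cast Finset.card_le_card h2
    refine le_trans ?_ ((hgrow i hi1 hiJ).trans h3)
    gcongr
  obtain ⟨r, H, Q, hr, hsym, hproper, hmem, hsize⟩ :=
    hprog T hbohrgrow (1 / (20 * l)) (by positivity) hlρ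
  refine ⟨r, H, Q, hr, hsym, hproper, fun g hg => hmem g (hXT hg), ?_⟩
  have h1 : 1 / (20 * (l : ℝ)) * J ≤ c + 1 := by
    rw [one_div_mul_eq_div, div_le_iff₀ (by positivity)]
    nlinarith
  have hrB : r ≤ ⌊B⌋₊ := (Nat.le_floor_iff hB).mpr hr
  calc (((H : Set G) + Q.toSet).ncard : ℝ) * J ^ r
      ≤ K * (1 / (20 * l)) ^ r * (bohrSet T (1 / 10)).card * J ^ r := by gcongr
    _ = K * (1 / (20 * l) * J) ^ r * (bohrSet T (1 / 10)).card := by rw [mul_pow]; ring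
    _ ≤ K * (c + 1) ^ r * (sumBall X J).card := by gcongr
    _ ≤ K * (c + 1) ^ ⌊B⌋₊ * (sumBall X J).card := by
      gcongr
      linarith

/-- Long-range inverse theorem: a symmetric set whose `k`-fold sumset has size polynomial in `k`
lies in a proper coset progression of bounded rank, of the size suggested by that sumset. -/
theorem exists_cosetProg_of_card_sumBall_le (C : ℝ) (hC : 0 ≤ C) : ∃ k₀ : ℕ, ∃ K : ℝ, 0 < K ∧
    ∀ {G : Type*} [AddCommGroup G] [Fintype G] (X : Finset G), 0 ∈ X → (∀ x ∈ X, -x ∈ X) →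
      ∀ k : ℕ, k₀ ≤ k → ((sumBall X k).card : ℝ) ≤ (k : ℝ) ^ C →
      ∃ (r : ℕ) (H : AddSubgroup G) (Q : GAPData G r), (r : ℝ) ≤ C + 1 ∧ Q.IsSymmetric ∧
        IsProperCosetProg H Q ∧ (∀ g ∈ X, g ∈ (H : Set G) + Q.toSet) ∧
        (((H : Set G) + Q.toSet).ncard : ℝ) * k ^ r ≤ K * (sumBall X k).card := by
  obtain ⟨J₀, K, hK, hJ⟩ := exists_cosetProg_of_growth (C + 1) (by linarith)
  refine ⟨⌈(J₀ : ℝ) ^ (C + 1)⌉₊ + 1, K, hK, ?_⟩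
  intro G _ _ X h0 hneg k hk hcard
  have hk1 : 1 ≤ k := by omega
  have hk0 : (0 : ℝ) < k := by exact_mod_cast hk1
  obtain ⟨J, hJmem, hJmin⟩ := Finset.exists_min_image (Finset.Icc 1 k)
    (fun j => ((sumBall X j).card : ℝ) / (j : ℝ) ^ (C + 1)) ⟨1, by simp [hk1]⟩
  rw [Finset.mem_Icc] at hJmem
  have hJ0 : (0 : ℝ) < J := by exact_mod_cast hJmem.1
  have hmin : ∀ i : ℕ, 1 ≤ i → i ≤ k →
      ((i : ℝ) / J) ^ (C + 1) * (sumBall X J).card ≤ (sumBall X i).card := by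
    intro i hi1 hik
    have h1 := hJmin i (Finset.mem_Icc.mpr ⟨hi1, hik⟩)
    have hi0 : (0 : ℝ) < i := by exact_mod_cast hi1
    rw [div_le_div_iff₀ (by positivity) (by positivity)] at h1
    rw [Real.div_rpow hi0.le hJ0.le, div_mul_eq_mul_div, div_le_iff₀ (by positivity)]
    linarith
  have hJlarge : J₀ ≤ J := by
    by_contra! hlt
    have h1 := hmin k hk1 le_rfl
    have h2 : (1 : ℝ) ≤ (sumBall X J).card := by exact_mod_cast card_sumBall_pos h0 J
    have h3 : ((k : ℝ) / J) ^ (C + 1) ≤ (k : ℝ) ^ C := by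
      refine le_trans ?_ (h1.trans hcard)
      exact le_mul_of_one_le_right (by positivity) h2
    rw [Real.div_rpow hk0.le hJ0.le, div_le_iff₀ (by positivity), Real.rpow_add_one hk0.ne',
      mul_le_mul_iff_right₀ (by positivity)] at h3
    have h4 : (J : ℝ) ^ (C + 1) ≤ (J₀ : ℝ) ^ (C + 1) :=
      Real.rpow_le_rpow hJ0.le (by exact_mod_cast hlt.le) (by linarith)
    have h5 := Nat.le_ceil ((J₀ : ℝ) ^ (C + 1))
    have h6 : ((⌈(J₀ : ℝ) ^ (C + 1)⌉₊ + 1 : ℕ) : ℝ) ≤ k := by exact_mod_cast hk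
    push_cast at h6
    linarith
  obtain ⟨r, H, Q, hr, hsym, hproper, hmem, hsize⟩ :=
    hJ X h0 hneg J hJlarge fun i hi1 hiJ => hmin i hi1 (hiJ.trans hJmem.2)
  refine ⟨r, H, Q, hr, hsym, hproper, hmem, ?_⟩
  have hkJ : (1 : ℝ) ≤ k / J := by
    rw [one_le_div hJ0]; exact_mod_cast hJmem.2
  have h1 : ((k : ℝ) / J) ^ r ≤ ((k : ℝ) / J) ^ (C + 1) := by
    rw [← Real.rpow_natCast]
    exact Real.rpow_le_rpow_of_exponent_le hkJ hr
  calc (((H : Set G) + Q.toSet).ncard : ℝ) * k ^ r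
      = ((H : Set G) + Q.toSet).ncard * J ^ r * (k / J) ^ r := by
        rw [div_pow]; field_simp
    _ ≤ K * (sumBall X J).card * (k / J) ^ (C + 1) := by gcongr
    _ = K * ((k / J) ^ (C + 1) * (sumBall X J).card) := by ring
    _ ≤ K * (sumBall X k).card := by gcongr; exact hmin k hk1 le_rfl

end LongRange

section LargeSpectrum

variable {G : Type*} [AddCommGroup G] [Fintype G]

theorem rhoWalkG_le {n : ℕ} (hn : 0 < n) (m : ℕ) {A : Fin n → G} (σ : Equiv.Perm (Fin n))
    (hσ : ∀ i, A (σ i) = -A i) :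
    rhoWalkG n m A * Fintype.card G ≤ ∑ χ : AddChar G ℂ, (|charSum A χ| / n) ^ m := by
  classical
  have hn' : (0 : ℝ) < n := by exact_mod_cast hn
  have hN : (0 : ℝ) < Fintype.card G := by exact_mod_cast Fintype.card_pos
  rw [← le_div_iff₀ hN]
  refine ciSup_le fun g => ?_
  have h1 := sum_charSum_pow_mul_re σ hσ m g
  have h2 : ({f : Fin m → Fin n | ∑ j, A (f j) = g}.ncard : ℝ) =
      (Finset.univ.filter fun f : Fin m → Fin n => ∑ j, A (f j) = g).card := by
    rw [Set.ncard_eq_toFinset_card']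
    simp
  have h3 : charSum A 0 = n := by simp [charSum]
  rw [← Finset.add_sum_erase _ _ (Finset.mem_univ (0 : AddChar G ℂ)), h3] at h1
  have h4 : ((0 : AddChar G ℂ) g).re = 1 := by simp
  rw [h4, mul_one] at h1
  have h5 : ({f : Fin m → Fin n | ∑ j, A (f j) = g}.ncard : ℝ) / (n : ℝ) ^ m -
      1 / (Fintype.card G : ℝ) = (∑ χ ∈ Finset.univ.erase (0 : AddChar G ℂ),
        (charSum A χ / n) ^ m * (χ g).re) / Fintype.card G := by
    have h6 : ∑ χ ∈ Finset.univ.erase (0 : AddChar G ℂ), (charSum A χ / n) ^ m * (χ g).re =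
        (∑ χ ∈ Finset.univ.erase (0 : AddChar G ℂ), charSum A χ ^ m * (χ g).re) / n ^ m := by
      rw [Finset.sum_div]
      refine Finset.sum_congr rfl fun χ _ => ?_
      rw [div_pow, div_mul_eq_mul_div]
    rw [h6, h2]
    field_simp
    linarith
  rw [h5, abs_div, abs_of_pos hN]
  gcongr
  refine (Finset.abs_sum_le_sum_abs _ _).trans ?_
  refine le_trans ?_ (Finset.sum_le_sum_of_subset_of_nonneg
    (Finset.erase_subset (0 : AddChar G ℂ) _) fun _ _ _ => by positivity)
  refine Finset.sum_le_sum fun χ _ => ?_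
  rw [abs_mul, abs_pow, abs_div, abs_of_pos hn']
  exact mul_le_of_le_one_right (by positivity) (addChar_abs_re_le_one χ g)

/-- Dyadic pigeonholing: a large `m`-th moment forces a large level set. -/
theorem exists_card_level_ge {α : Type*} [Fintype α] {F : α → ℝ} (hF0 : ∀ x, 0 ≤ F x)
    (hF1 : ∀ x, F x ≤ 1) {m : ℕ} (hm : 0 < m) {ρ : ℝ} (hρ : 0 < ρ) [Nonempty α]
    (hsum : ρ * Fintype.card α ≤ ∑ x, F x ^ m) {p : ℕ} (hp : (1 / 2 : ℝ) ^ p ≤ ρ / 2) :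
    ∃ i < p, 1 / 8 * (4 / 3) ^ i * (ρ * Fintype.card α) ≤
      ((Finset.univ.filter fun x => 1 - ((i + 1 : ℕ) : ℝ) / m ≤ F x).card : ℝ) := by
  classical
  by_contra! hcon
  have hm' : (0 : ℝ) < m := by exact_mod_cast hm
  have hN : (0 : ℝ) < Fintype.card α := by exact_mod_cast Fintype.card_pos
  have hpt : ∀ x, F x ^ m ≤ (∑ i ∈ Finset.range p,
      if 1 - ((i + 1 : ℕ) : ℝ) / m ≤ F x then (1 / 2 : ℝ) ^ i else 0) + (1 / 2) ^ p := by
    intro x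
    have hu : 0 ≤ m * (1 - F x) := mul_nonneg hm'.le (by linarith [hF1 x])
    set i := ⌊m * (1 - F x)⌋₊ with hi
    have h1 : F x ^ m ≤ (1 / 2) ^ i := by
      have h2 : F x ≤ Real.exp (-(1 - F x)) := by
        have := Real.add_one_le_exp (-(1 - F x))
        linarith
      have h3 : Real.exp (-1) ≤ 1 / 2 := by
        rw [Real.exp_neg, inv_eq_one_div]
        have := Real.add_one_le_exp 1
        exact one_div_le_one_div_of_le (by norm_num) (by linarith)
      calc F x ^ m ≤ Real.exp (-(1 - F x)) ^ m := pow_le_pow_left₀ (hF0 x) h2 m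
        _ = Real.exp (-(m * (1 - F x))) := by rw [← Real.exp_nat_mul]; ring_nf
        _ ≤ Real.exp (i * (-1)) := by
          rw [Real.exp_le_exp]
          have := Nat.floor_le hu
          rw [← hi] at this
          linarith
        _ = Real.exp (-1) ^ i := Real.exp_nat_mul _ _
        _ ≤ (1 / 2) ^ i := pow_le_pow_left₀ (Real.exp_pos _).le h3 i
    have hnn : ∀ j ∈ Finset.range p,
        0 ≤ if 1 - ((j + 1 : ℕ) : ℝ) / m ≤ F x then (1 / 2 : ℝ) ^ j else 0 := by
      intro j _
      split_ifs <;> positivity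
    by_cases hip : i < p
    · have h2 := Finset.single_le_sum hnn (Finset.mem_range.mpr hip)
      have h3 : 1 - ((i + 1 : ℕ) : ℝ) / m ≤ F x := by
        have h4 := (Nat.lt_floor_add_one (m * (1 - F x))).le
        rw [← hi] at h4
        have h5 : 1 - F x ≤ ((i + 1 : ℕ) : ℝ) / m := by
          rw [le_div_iff₀ hm']
          push_cast
          linarith
        linarith
      rw [if_pos h3] at h2
      have h4 : (0 : ℝ) ≤ (1 / 2) ^ p := by positivity
      linarith
    · have h2 := Finset.sum_nonneg hnn
      have h3 : (1 / 2 : ℝ) ^ i ≤ (1 / 2) ^ p :=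
        pow_le_pow_of_le_one (by norm_num) (by norm_num) (not_lt.mp hip)
      linarith
  have h1 := Finset.sum_le_sum fun x (_ : x ∈ Finset.univ) => hpt x
  rw [Finset.sum_add_distrib, Finset.sum_comm, Finset.sum_const, nsmul_eq_mul,
    Finset.card_univ] at h1
  have h2 : ∑ i ∈ Finset.range p, ∑ x : α,
      (if 1 - ((i + 1 : ℕ) : ℝ) / m ≤ F x then (1 / 2 : ℝ) ^ i else 0) ≤
      ∑ i ∈ Finset.range p, (2 / 3 : ℝ) ^ i * (1 / 8 * (ρ * Fintype.card α)) := by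
    refine Finset.sum_le_sum fun i hi => ?_
    rw [← Finset.sum_filter, Finset.sum_const, nsmul_eq_mul]
    have h3 := (hcon i (Finset.mem_range.mp hi)).le
    calc _ ≤ 1 / 8 * (4 / 3) ^ i * (ρ * Fintype.card α) * (1 / 2 : ℝ) ^ i := by gcongr
      _ = (4 / 3 * (1 / 2) : ℝ) ^ i * (1 / 8 * (ρ * Fintype.card α)) := by rw [mul_pow]; ring
      _ = _ := by norm_num
  have h3 : ∑ i ∈ Finset.range p, (2 / 3 : ℝ) ^ i ≤ 3 := by
    have h4 := geom_sum_mul_neg (2 / 3 : ℝ) p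
    have h5 : (0 : ℝ) ≤ (2 / 3) ^ p := by positivity
    linarith
  rw [← Finset.sum_mul] at h2
  have h4 : 0 < ρ * Fintype.card α := by positivity
  have h5 := mul_le_mul_of_nonneg_right h3 (by positivity : 0 ≤ 1 / 8 * (ρ * Fintype.card α))
  have h6 := mul_le_mul_of_nonneg_left hp hN.le
  linarith

theorem sum_norm_sub_addChar_sq {n : ℕ} (A : Fin n → G) (χ : AddChar G ℂ) (θ : ℝ)
    (hθ : θ ^ 2 = 1) : ∑ i, ‖(θ : ℂ) - χ (A i)‖ ^ 2 = 2 * (n - θ * charSum A χ) := by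
  simp only [norm_sub_addChar_sq _ _ _ hθ, Finset.sum_sub_distrib, Finset.sum_const, nsmul_eq_mul,
    ← Finset.mul_sum, charSum, Finset.card_univ, Fintype.card_fin]
  ring

theorem exists_charSum_ge {n : ℕ} (A : Fin n → G) {θ : ℝ} (hθ : 0 ≤ θ) :
    ∃ S : Finset (AddChar G ℂ), (∀ χ ∈ S, (1 - 4 * θ) * n ≤ charSum A χ) ∧
      (Finset.univ.filter fun χ : AddChar G ℂ => (1 - θ) * n ≤ |charSum A χ|).card ≤
        2 * S.card := by
  classical
  set P := Finset.univ.filter fun χ : AddChar G ℂ => (1 - θ) * n ≤ charSum A χ with hP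
  set M := Finset.univ.filter fun χ : AddChar G ℂ => (1 - θ) * n ≤ -charSum A χ with hM
  have hcard : (Finset.univ.filter fun χ : AddChar G ℂ => (1 - θ) * n ≤ |charSum A χ|).card ≤
      P.card + M.card := by
    rw [hP, hM]
    simp only [le_abs, Finset.filter_or]
    exact Finset.card_union_le _ _
  have hn0 : (0 : ℝ) ≤ θ * n := by positivity
  rcases le_total M.card P.card with h | h
  · refine ⟨P, fun χ hχ => ?_, by omega⟩
    have := (Finset.mem_filter.mp hχ).2
    nlinarith
  · rcases M.eq_empty_or_nonempty with h0 | ⟨ψ, hψ⟩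
    · refine ⟨∅, by simp, ?_⟩
      rw [h0, Finset.card_empty] at h hcard
      simp only [Finset.card_empty]
      omega
    · refine ⟨M.image fun χ => ψ * χ, ?_, ?_⟩
      · intro φ hφ
        obtain ⟨χ, hχ, rfl⟩ := Finset.mem_image.mp hφ
        have h1 := (Finset.mem_filter.mp hψ).2
        have h2 := (Finset.mem_filter.mp hχ).2
        have h3 : ∀ i, ‖((1 : ℝ) : ℂ) - (ψ * χ) (A i)‖ ^ 2 ≤
            2 * ‖((-1 : ℝ) : ℂ) - ψ (A i)‖ ^ 2 + 2 * ‖((-1 : ℝ) : ℂ) - χ (A i)‖ ^ 2 := by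
          intro i
          have h4 : ((1 : ℝ) : ℂ) - (ψ * χ) (A i) =
              -(((-1 : ℝ) : ℂ) - ψ (A i)) + ψ (A i) * (((-1 : ℝ) : ℂ) - χ (A i)) := by
            rw [AddChar.mul_apply]; push_cast; ring
          rw [h4]
          refine (norm_add_sq_le_two_mul _ _).trans ?_
          rw [norm_neg, norm_mul, AddChar.norm_apply, one_mul]
        have h4 := Finset.sum_le_sum fun i (_ : i ∈ Finset.univ) => h3 i
        rw [Finset.sum_add_distrib, ← Finset.mul_sum, ← Finset.mul_sum,
          sum_norm_sub_addChar_sq _ _ _ (by norm_num), sum_norm_sub_addChar_sq _ _ _ (by norm_num),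
          sum_norm_sub_addChar_sq _ _ _ (by norm_num)] at h4
        linarith
      · rw [Finset.card_image_of_injective _ (mul_right_injective ψ)]
        omega

/-- The elements at which the characters of `S` are within `β` of one on average. -/
noncomputable def almostPeriods (S : Finset (AddChar G ℂ)) (β : ℝ) : Finset G :=
  Finset.univ.filter fun g => ∑ χ ∈ S, ‖1 - χ g‖ ≤ β * S.card

variable {S : Finset (AddChar G ℂ)} {β : ℝ}

theorem mem_almostPeriods {g : G} :
    g ∈ almostPeriods S β ↔ ∑ χ ∈ S, ‖1 - χ g‖ ≤ β * S.card := by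
  simp [almostPeriods]

theorem zero_mem_almostPeriods (hβ : 0 ≤ β) : (0 : G) ∈ almostPeriods S β := by
  rw [mem_almostPeriods]
  simp only [AddChar.map_zero_eq_one, sub_self, norm_zero, Finset.sum_const_zero]
  positivity

theorem neg_mem_almostPeriods {g : G} (hg : g ∈ almostPeriods S β) : -g ∈ almostPeriods S β := by
  rw [mem_almostPeriods] at hg ⊢
  refine le_of_eq_of_le (Finset.sum_congr rfl fun χ _ => ?_) hg
  rw [AddChar.map_neg_eq_conj, ← Complex.norm_conj (1 - χ g), map_sub, map_one]

theorem sum_norm_one_sub_le_of_mem_sumBall {k : ℕ} {g : G}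
    (hg : g ∈ sumBall (almostPeriods S β) k) : ∑ χ ∈ S, ‖1 - χ g‖ ≤ k * (β * S.card) := by
  induction k generalizing g with
  | zero => rw [mem_sumBall_zero.mp hg]; simp
  | succ k ih =>
    obtain ⟨h, hh, x, hx, rfl⟩ := mem_sumBall_succ.mp hg
    have h1 := ih hh
    have h2 := mem_almostPeriods.mp hx
    have h3 : ∀ χ ∈ S, ‖1 - χ (h + x)‖ ≤ ‖1 - χ h‖ + ‖1 - χ x‖ := by
      intro χ _
      have h4 : 1 - χ (h + x) = (1 - χ h) + χ h * (1 - χ x) := by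
        rw [AddChar.map_add_eq_mul]; ring
      rw [h4]
      refine (norm_add_le _ _).trans ?_
      rw [norm_mul, AddChar.norm_apply, one_mul]
    refine (Finset.sum_le_sum h3).trans ?_
    rw [Finset.sum_add_distrib]
    push_cast
    linarith

theorem sum_norm_sum_addChar_sq (S : Finset (AddChar G ℂ)) :
    ∑ g : G, ‖∑ χ ∈ S, χ g‖ ^ 2 = Fintype.card G * S.card := by
  classical
  have h1 : ∑ g : G, ((‖∑ χ ∈ S, χ g‖ ^ 2 : ℝ) : ℂ) = Fintype.card G * S.card := by
    have h2 : ∀ g : G, ((‖∑ χ ∈ S, χ g‖ ^ 2 : ℝ) : ℂ) = ∑ χ ∈ S, ∑ ψ ∈ S, (χ * ψ⁻¹) g := by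
      intro g
      rw [Complex.ofReal_pow, ← Complex.mul_conj', map_sum, Finset.sum_mul_sum]
      refine Finset.sum_congr rfl fun χ _ => Finset.sum_congr rfl fun ψ _ => ?_
      rw [AddChar.mul_apply, AddChar.inv_apply', AddChar.inv_apply_eq_conj]
    simp only [h2]
    rw [Finset.sum_comm]
    have h3 : ∀ χ ∈ S, ∑ g : G, ∑ ψ ∈ S, (χ * ψ⁻¹) g = Fintype.card G := by
      intro χ hχ
      rw [Finset.sum_comm]
      have h4 : ∀ ψ ∈ S, ∑ g : G, (χ * ψ⁻¹) g = if χ = ψ then (Fintype.card G : ℂ) else 0 := by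
        intro ψ _
        rw [AddChar.sum_eq_ite]
        refine if_congr ?_ rfl rfl
        rw [← AddChar.one_eq_zero, mul_inv_eq_one]
      rw [Finset.sum_congr rfl h4, Finset.sum_ite_eq, if_pos hχ]
    rw [Finset.sum_congr rfl h3, Finset.sum_const, nsmul_eq_mul, mul_comm]
  exact_mod_cast h1

theorem card_sumBall_almostPeriods_mul_card_le {k : ℕ} (hk : k * β ≤ 1 / 2) :
    ((sumBall (almostPeriods S β) k).card : ℝ) * S.card ≤ 4 * Fintype.card G := by
  rcases S.eq_empty_or_nonempty with rfl | hS
  · simp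
  have hS0 : (0 : ℝ) < S.card := by exact_mod_cast hS.card_pos
  have h1 : ∀ g ∈ sumBall (almostPeriods S β) k,
      (S.card : ℝ) ^ 2 / 4 ≤ ‖∑ χ ∈ S, χ g‖ ^ 2 := by
    intro g hg
    have h2 := sum_norm_one_sub_le_of_mem_sumBall hg
    have h3 : (S.card : ℂ) - ∑ χ ∈ S, χ g = ∑ χ ∈ S, (1 - χ g) := by
      simp [Finset.sum_sub_distrib]
    have h4 := norm_sub_norm_le (S.card : ℂ) (∑ χ ∈ S, χ g)
    rw [h3, Complex.norm_natCast] at h4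
    have h5 := h4.trans (norm_sum_le _ _)
    have h6 : (S.card : ℝ) / 2 ≤ ‖∑ χ ∈ S, χ g‖ := by nlinarith
    nlinarith
  have h2 := Finset.sum_le_sum h1
  rw [Finset.sum_const, nsmul_eq_mul] at h2
  have h3 := h2.trans (Finset.sum_le_sum_of_subset_of_nonneg (Finset.subset_univ _)
    fun _ _ _ => sq_nonneg _)
  rw [sum_norm_sum_addChar_sq] at h3
  have h4 : ((sumBall (almostPeriods S β) k).card * S.card : ℝ) * (S.card / 4) ≤
      4 * Fintype.card G * (S.card / 4) := by nlinarith
  exact le_of_mul_le_mul_right h4 (by positivity)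

theorem card_filter_notMem_almostPeriods_le {n : ℕ} {A : Fin n → G} {θ ε : ℝ} (hβ : 0 < β)
    (hS : S.Nonempty) (hβθ : 8 * θ ≤ ε * β ^ 2) [DecidableEq G]
    (hA : ∀ χ ∈ S, (1 - 4 * θ) * n ≤ charSum A χ) :
    ((Finset.univ.filter fun i => A i ∉ almostPeriods S β).card : ℝ) ≤ ε * n := by
  have hS0 : (0 : ℝ) < S.card := by exact_mod_cast hS.card_pos
  set D := Finset.univ.filter fun i => A i ∉ almostPeriods S β with hD
  have h1 : ∑ i, (∑ χ ∈ S, ‖1 - χ (A i)‖) ^ 2 ≤ 8 * θ * n * S.card ^ 2 := by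
    calc ∑ i, (∑ χ ∈ S, ‖1 - χ (A i)‖) ^ 2
        ≤ ∑ i, S.card * ∑ χ ∈ S, ‖1 - χ (A i)‖ ^ 2 :=
          Finset.sum_le_sum fun i _ => sq_sum_le_card_mul_sum_sq
      _ = S.card * ∑ χ ∈ S, ∑ i, ‖((1 : ℝ) : ℂ) - χ (A i)‖ ^ 2 := by
        rw [← Finset.mul_sum, Finset.sum_comm, Complex.ofReal_one]
      _ ≤ S.card * ∑ χ ∈ S, 8 * θ * n := by
        gcongr with χ hχ
        rw [sum_norm_sub_addChar_sq _ _ _ (by norm_num)]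
        linarith [hA χ hχ]
      _ = _ := by rw [Finset.sum_const, nsmul_eq_mul]; ring
  have h2 : (D.card : ℝ) * (β * S.card) ^ 2 ≤ ∑ i, (∑ χ ∈ S, ‖1 - χ (A i)‖) ^ 2 := by
    rw [← nsmul_eq_mul, ← Finset.sum_const]
    refine le_trans (Finset.sum_le_sum fun i hi => ?_) (Finset.sum_le_sum_of_subset_of_nonneg
      (Finset.subset_univ D) fun _ _ _ => sq_nonneg _)
    have h3 := (Finset.mem_filter.mp hi).2
    rw [mem_almostPeriods, not_le] at h3
    exact pow_le_pow_left₀ (by positivity) h3.le 2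
  have h3 : (D.card : ℝ) * (β * S.card) ^ 2 ≤ ε * n * (β * S.card) ^ 2 := by
    refine (h2.trans h1).trans ?_
    have h4 := mul_le_mul_of_nonneg_right hβθ (by positivity : (0 : ℝ) ≤ n * S.card ^ 2)
    linarith
  exact le_of_mul_le_mul_right h3 (by positivity)

end LargeSpectrum

section RandomWalk

theorem exists_forall_pow_mul_pow_le (R : ℕ) :
    ∃ M : ℝ, 0 < M ∧ ∀ i : ℕ, ((i + 1 : ℕ) : ℝ) ^ R * (3 / 4) ^ i ≤ M := by
  have h1 := tendsto_pow_const_mul_const_pow_of_abs_lt_one R (r := (3 / 4 : ℝ))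
    (by rw [abs_of_pos] <;> norm_num)
  obtain ⟨M, hM⟩ := h1.bddAbove_range
  refine ⟨4 / 3 * (|M| + 1), by positivity, fun i => ?_⟩
  have h2 := hM ⟨i + 1, rfl⟩
  simp only [pow_succ] at h2
  have h3 := le_abs_self M
  linarith

/-- The thresholds at which all the asymptotic comparisons of the argument hold. -/
theorem exists_scale (C ε : ℝ) (hε : 0 < ε) (k₀ : ℕ) : ∃ m₀ : ℕ, ∀ m : ℕ, m₀ ≤ m →
    ∃ p : ℕ, k₀ ≤ p ∧ 1 ≤ p ∧ p ^ 4 ≤ m ∧ m ≤ p ^ 5 ∧ 64 ≤ m ∧ 32 ≤ ε * p ∧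
      (1 / 2 : ℝ) ^ p ≤ (m : ℝ) ^ (-C) / 2 := by
  have h1 := tendsto_pow_const_mul_const_pow_of_abs_lt_one (4 * ⌈C⌉₊) (r := (1 / 2 : ℝ))
    (by rw [abs_of_pos] <;> norm_num)
  have h2 : (0 : ℝ) < 1 / (2 * 16 ^ ⌈C⌉₊) := by positivity
  obtain ⟨p₀, hp₀⟩ := Filter.eventually_atTop.mp (h1.eventually (gt_mem_nhds h2))
  set p₁ := p₀ + k₀ + ⌈32 / ε⌉₊ + 16 with hp₁
  refine ⟨p₁ ^ 4, fun m hm => ?_⟩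
  set q := Nat.sqrt m with hq
  set p := Nat.sqrt q with hp
  have hq1 : q * q ≤ m := Nat.sqrt_le m
  have hq2 : m < (q + 1) * (q + 1) := Nat.lt_succ_sqrt m
  have hp1 : p * p ≤ q := Nat.sqrt_le q
  have hp2 : q < (p + 1) * (p + 1) := Nat.lt_succ_sqrt q
  have hp1p : p₁ ≤ p := by
    rw [hp, Nat.le_sqrt, hq, Nat.le_sqrt]
    calc _ = p₁ ^ 4 := by ring
      _ ≤ m := hm
  have hp16 : 16 ≤ p := by omega
  have hpm : p ^ 4 ≤ m := by
    calc p ^ 4 = (p * p) * (p * p) := by ring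
      _ ≤ q * q := Nat.mul_le_mul hp1 hp1
      _ ≤ m := hq1
  have hmp : m ≤ 16 * p ^ 4 := by
    have h3 : q + 1 ≤ (2 * p) * (2 * p) := by nlinarith
    calc m ≤ (q + 1) * (q + 1) := hq2.le
      _ ≤ ((2 * p) * (2 * p)) * ((2 * p) * (2 * p)) := Nat.mul_le_mul h3 h3
      _ = 16 * p ^ 4 := by ring
  refine ⟨p, by omega, by omega, hpm, ?_, ?_, ?_, ?_⟩
  · calc m ≤ 16 * p ^ 4 := hmp
      _ ≤ p * p ^ 4 := by gcongr
      _ = p ^ 5 := by ring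
  · calc 64 ≤ 16 ^ 4 := by norm_num
      _ ≤ p ^ 4 := by gcongr
      _ ≤ m := hpm
  · have h3 := Nat.le_ceil (32 / ε)
    have h4 : (⌈32 / ε⌉₊ : ℝ) ≤ p := by exact_mod_cast (by omega)
    have h5 := h3.trans h4
    rw [div_le_iff₀ hε] at h5
    linarith
  · have h3 := hp₀ p (by omega)
    have hm1 : (1 : ℝ) ≤ m := by exact_mod_cast (Nat.one_le_pow 4 p (by omega)).trans hpm
    have hmC : (m : ℝ) ^ C ≤ 16 ^ ⌈C⌉₊ * (p : ℝ) ^ (4 * ⌈C⌉₊) := by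
      calc (m : ℝ) ^ C ≤ (m : ℝ) ^ (⌈C⌉₊ : ℝ) :=
            Real.rpow_le_rpow_of_exponent_le hm1 (Nat.le_ceil C)
        _ = (m : ℝ) ^ ⌈C⌉₊ := Real.rpow_natCast _ _
        _ ≤ (16 * (p : ℝ) ^ 4) ^ ⌈C⌉₊ := by
          gcongr
          exact_mod_cast hmp
        _ = _ := by rw [mul_pow, pow_mul]
    have hmC0 : (0 : ℝ) < (m : ℝ) ^ C := by positivity
    rw [Real.rpow_neg (by positivity), ← one_div, div_div, le_div_iff₀ (by positivity)]
    rw [lt_div_iff₀ (by positivity)] at h3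
    calc (1 / 2 : ℝ) ^ p * ((m : ℝ) ^ C * 2)
        ≤ (1 / 2 : ℝ) ^ p * ((16 ^ ⌈C⌉₊ * (p : ℝ) ^ (4 * ⌈C⌉₊)) * 2) := by gcongr
      _ = (p : ℝ) ^ (4 * ⌈C⌉₊) * (1 / 2) ^ p * (2 * 16 ^ ⌈C⌉₊) := by ring
      _ ≤ 1 := h3.le

/-- The set of almost periods attached to a level set of the spectrum of a random walk. -/
theorem exists_large_almostPeriods {G : Type*} [AddCommGroup G] [Fintype G] [DecidableEq G]
    {n : ℕ} (hn : 0 < n) {m p : ℕ} (hm : 0 < m) {A : Fin n → G} (σ : Equiv.Perm (Fin n))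
    (hσ : ∀ i, A (σ i) = -A i) (hρ : 0 < rhoWalkG n m A)
    (hp : (1 / 2 : ℝ) ^ p ≤ rhoWalkG n m A / 2) {ε : ℝ} :
    ∃ i < p, ∀ β : ℝ, 0 < β → 8 * (((i + 1 : ℕ) : ℝ) / m) ≤ ε * β ^ 2 →
      ∃ X : Finset G, 0 ∈ X ∧ (∀ x ∈ X, -x ∈ X) ∧
        ((Finset.univ.filter fun j => A j ∉ X).card : ℝ) ≤ ε * n ∧
        ∀ k : ℕ, k * β ≤ 1 / 2 →
          ((sumBall X k).card : ℝ) * rhoWalkG n m A ≤ 64 * (3 / 4) ^ i := by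
  have hn' : (0 : ℝ) < n := by exact_mod_cast hn
  have hN : (0 : ℝ) < Fintype.card G := by exact_mod_cast Fintype.card_pos
  have hsum := rhoWalkG_le hn m σ hσ
  set ρ := rhoWalkG n m A with hρdef
  rw [← AddChar.card_eq (α := G)] at hsum
  obtain ⟨i, hip, hi⟩ := exists_card_level_ge (F := fun χ : AddChar G ℂ => |charSum A χ| / n)
    (fun χ => by positivity) (fun χ => by
      rw [div_le_one hn']
      simpa using abs_charSum_le A χ) hm hρ hsum hp
  refine ⟨i, hip, fun β hβ hβθ => ?_⟩
  obtain ⟨S, hS, hScard⟩ := exists_charSum_ge A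
    (θ := ((i + 1 : ℕ) : ℝ) / m) (by positivity)
  rw [AddChar.card_eq] at hi
  simp only [le_div_iff₀ hn'] at hi
  have hScard' : 1 / 8 * (4 / 3) ^ i * (ρ * Fintype.card G) ≤ 2 * (S.card : ℝ) :=
    hi.trans (by exact_mod_cast hScard)
  have hS0 : (0 : ℝ) < S.card := by
    have : 0 < 1 / 8 * (4 / 3 : ℝ) ^ i * (ρ * Fintype.card G) := by positivity
    linarith
  have hSne : S.Nonempty := Finset.card_pos.mp (by exact_mod_cast hS0)
  refine ⟨almostPeriods S β, zero_mem_almostPeriods hβ.le, fun x hx => neg_mem_almostPeriods hx,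
    card_filter_notMem_almostPeriods_le hβ hSne hβθ hS, fun k hk => ?_⟩
  have h1 := card_sumBall_almostPeriods_mul_card_le (S := S) hk
  set b : ℝ := ((sumBall (almostPeriods S β) k).card : ℝ) with hb
  have hb0 : 0 ≤ b := Nat.cast_nonneg _
  have h2 : (4 / 3 : ℝ) ^ i * (3 / 4) ^ i = 1 := by rw [← mul_pow]; norm_num
  have h3 : (b * ρ) * (4 / 3) ^ i * Fintype.card G ≤ 64 * Fintype.card G := by
    have h4 := mul_le_mul_of_nonneg_left hScard' hb0
    linarith
  have h4 := le_of_mul_le_mul_right h3 hN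
  calc b * ρ = (b * ρ) * (4 / 3) ^ i * (3 / 4) ^ i := by rw [mul_assoc, h2, mul_one]
    _ ≤ 64 * (3 / 4) ^ i := by gcongr

end RandomWalk

theorem stmt12 (ε C : ℝ) (hε0 : 0 < ε) (hε1 : ε < 1) (hC : 0 < C) :
    ∃ (r₀ : ℕ) (K : ℝ) (m₀ : ℕ), ∀ m : ℕ, m₀ ≤ m →
      ∀ (G : Type) [AddCommGroup G] [Fintype G],
        ∀ (n : ℕ) (A : Fin n → G),
          (∃ σ : Equiv.Perm (Fin n), ∀ i, A (σ i) = -A i) →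
          (m : ℝ) ^ (-C) ≤ rhoWalkG n m A →
          ∀ n' : ℕ, ε * n ≤ (n' : ℝ) → n' ≤ n →
            ∃ (r : ℕ) (H : AddSubgroup G) (Q : GAPData G r),
              r ≤ r₀ ∧ Q.IsSymmetric ∧ IsProperCosetProg H Q ∧
              n - n' ≤ {i : Fin n | A i ∈ (H : Set G) + Q.toSet}.ncard ∧
              (((H : Set G) + Q.toSet).ncard : ℝ) ≤
                max 1 (K * (rhoWalkG n m A)⁻¹ /
                  ((m : ℝ) * (n' : ℝ) / (n : ℝ)) ^ ((r : ℝ) / 2)) := by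
  obtain ⟨k₀, K, hK, hlong⟩ := exists_cosetProg_of_card_sumBall_le (5 * (C + 1)) (by positivity)
  set R := ⌊5 * (C + 1) + 1⌋₊ with hR
  obtain ⟨M, hM, hMbound⟩ := exists_forall_pow_mul_pow_le R
  obtain ⟨m₀, hm₀⟩ := exists_scale C ε hε0 k₀
  refine ⟨R, K * 64 * M * (128 / ε) ^ R, m₀, ?_⟩
  intro m hm G _ _ n A ⟨σ, hσ⟩ hρ n' hn' hn'n
  classical
  obtain ⟨p, hk₀p, hp1, hpm, hmp, hm64, hεp, hp⟩ := hm₀ m hm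
  have hm0 : 0 < m := by omega
  have hm' : (0 : ℝ) < m := by exact_mod_cast hm0
  rcases Nat.eq_zero_or_pos n with rfl | hn
  · let Q : GAPData G 0 := ⟨0, Fin.elim0, Fin.elim0, Fin.elim0, fun i => i.elim0⟩
    have hQ : Q.toSet = {0} := by
      ext x
      simp [GAPData.toSet, Q]
    refine ⟨0, ⊥, Q, Nat.zero_le _, ⟨rfl, fun i => i.elim0⟩, ⟨Set.toFinite _, ?_, ?_⟩,
      by simp, ?_⟩
    · intro a b _ _ _
      exact Subsingleton.elim a b
    · simp [hQ]
    · simp [hQ]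
  have hn0 : (0 : ℝ) < n := by exact_mod_cast hn
  have hρ0 : 0 < rhoWalkG n m A := lt_of_lt_of_le (by positivity) hρ
  obtain ⟨i, hip, hi⟩ := exists_large_almostPeriods hn hm0 σ hσ hρ0
    (hp.trans (by linarith)) (ε := ε)
  set t : ℝ := ((i + 1 : ℕ) : ℝ) with ht
  have ht1 : 1 ≤ t := by rw [ht]; exact_mod_cast Nat.succ_le_succ (Nat.zero_le i)
  have htp : t ≤ p := by rw [ht]; exact_mod_cast hip
  set w : ℝ := Real.sqrt (ε * m / (32 * t)) with hw
  have hw2 : w ^ 2 = ε * m / (32 * t) := Real.sq_sqrt (by positivity)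
  have hw0 : 0 < w := Real.sqrt_pos.mpr (by positivity)
  have hp1' : (1 : ℝ) ≤ p := by exact_mod_cast hp1
  have hpw : (p : ℝ) ≤ w := by
    refine Real.le_sqrt_of_sq_le ?_
    rw [le_div_iff₀ (by positivity)]
    have h1 : (p : ℝ) ^ 4 ≤ m := by exact_mod_cast hpm
    calc (p : ℝ) ^ 2 * (32 * t) ≤ (p : ℝ) ^ 2 * (ε * p * p) := by gcongr
      _ = ε * p ^ 4 := by ring
      _ ≤ ε * m := by gcongr
  set k := ⌊w⌋₊ with hk
  have hkw : (k : ℝ) ≤ w := Nat.floor_le hw0.le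
  have hpk : p ≤ k := Nat.le_floor hpw
  have hk1 : (1 : ℝ) ≤ k := by exact_mod_cast hp1.trans hpk
  have hwk : w ≤ 2 * k := by
    have := (Nat.lt_floor_add_one w).le
    rw [← hk] at this
    linarith
  obtain ⟨X, h0, hneg, hXA, hXk⟩ := hi (1 / (2 * w)) (by positivity) (by
    refine le_of_eq ?_
    rw [div_pow, mul_pow, hw2]
    field_simp
    norm_num)
  have hball := hXk k (by
    rw [mul_one_div, div_le_iff₀ (by positivity)]
    linarith)
  have h34 : (3 / 4 : ℝ) ^ i ≤ 1 := pow_le_one₀ (by norm_num) (by norm_num)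
  have hpoly : ((sumBall X k).card : ℝ) ≤ (k : ℝ) ^ (5 * (C + 1)) := by
    have h1 : ((sumBall X k).card : ℝ) * (m : ℝ) ^ (-C) ≤ m := by
      calc ((sumBall X k).card : ℝ) * (m : ℝ) ^ (-C)
          ≤ (sumBall X k).card * rhoWalkG n m A := by gcongr
        _ ≤ 64 * (3 / 4) ^ i := hball
        _ ≤ 64 := by linarith
        _ ≤ m := by exact_mod_cast hm64
    rw [Real.rpow_neg hm'.le, ← div_eq_mul_inv, div_le_iff₀ (by positivity)] at h1
    have h2 : (m : ℝ) ≤ (k : ℝ) ^ (5 : ℝ) := by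
      have h3 : (m : ℝ) ≤ (k : ℝ) ^ 5 := by
        exact_mod_cast hmp.trans (Nat.pow_le_pow_left hpk 5)
      exact_mod_cast h3
    calc ((sumBall X k).card : ℝ) ≤ m * (m : ℝ) ^ C := h1
      _ = (m : ℝ) ^ (C + 1) := by rw [Real.rpow_add_one hm'.ne', mul_comm]
      _ ≤ ((k : ℝ) ^ (5 : ℝ)) ^ (C + 1) := Real.rpow_le_rpow hm'.le h2 (by positivity)
      _ = _ := (Real.rpow_mul (by positivity) _ _).symm
  obtain ⟨r, H, Q, hr, hsym, hproper, hmem, hsize⟩ := hlong X h0 hneg k (hk₀p.trans hpk) hpoly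
  have hrR : r ≤ R := Nat.le_floor hr
  refine ⟨r, H, Q, hrR, hsym, hproper, ?_, le_max_of_le_right ?_⟩
  · have h1 : (Finset.univ.filter fun j => A j ∉ X).card ≤ n' := by
      exact_mod_cast hXA.trans hn'
    have h2 := Finset.card_filter_add_card_filter_not (s := Finset.univ) fun j => A j ∈ X
    rw [Finset.card_univ, Fintype.card_fin] at h2
    have h3 : (Finset.univ.filter fun j => A j ∈ X).card ≤
        {i : Fin n | A i ∈ (H : Set G) + Q.toSet}.ncard := by
      rw [← Set.ncard_coe_finset]
      refine Set.ncard_le_ncard ?_ (Set.toFinite _)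
      intro j hj
      exact hmem _ (Finset.mem_filter.mp hj).2
    omega
  · have hn'0 : (0 : ℝ) < n' := lt_of_lt_of_le (by positivity) hn'
    have hz : (m : ℝ) * n' / n ≤ m := by
      rw [div_le_iff₀ hn0]
      gcongr
    have hz0 : (0 : ℝ) < m * n' / n := by positivity
    rw [le_div_iff₀ (by positivity), ← div_eq_mul_inv, le_div_iff₀ hρ0]
    have hmk : (m : ℝ) ≤ 128 / ε * t * k ^ 2 := by
      have h1 : ε * m / (32 * t) ≤ 4 * k ^ 2 := by
        rw [← hw2]
        nlinarith
      rw [div_le_iff₀ (by positivity)] at h1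
      rw [div_mul_eq_mul_div, div_mul_eq_mul_div, le_div_iff₀ hε0]
      linarith
    have h128 : 1 ≤ 128 / ε := by rw [one_le_div hε0]; linarith
    have hzr : ((m : ℝ) * n' / n) ^ ((r : ℝ) / 2) ≤ (128 / ε) ^ R * t ^ R * k ^ r := by
      calc ((m : ℝ) * n' / n) ^ ((r : ℝ) / 2)
          ≤ (128 / ε * t * k ^ 2) ^ ((r : ℝ) / 2) :=
            Real.rpow_le_rpow hz0.le (hz.trans hmk) (by positivity)
        _ = (128 / ε * t) ^ ((r : ℝ) / 2) * k ^ r := by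
          rw [Real.mul_rpow (by positivity) (by positivity), ← Real.rpow_natCast_mul (by positivity),
            ← Real.rpow_natCast (k : ℝ) r]
          congr 2
          push_cast
          ring
        _ ≤ (128 / ε * t) ^ (R : ℝ) * k ^ r := by
          gcongr
          · exact one_le_mul_of_one_le_of_one_le h128 ht1
          · have : (r : ℝ) ≤ R := by exact_mod_cast hrR
            linarith [r.cast_nonneg (α := ℝ)]
        _ = _ := by rw [Real.rpow_natCast, mul_pow]
    calc (((H : Set G) + Q.toSet).ncard : ℝ) * ((m : ℝ) * n' / n) ^ ((r : ℝ) / 2) *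
          rhoWalkG n m A
        ≤ ((H : Set G) + Q.toSet).ncard * ((128 / ε) ^ R * t ^ R * k ^ r) * rhoWalkG n m A := by
          gcongr
      _ = (((H : Set G) + Q.toSet).ncard * k ^ r) * ((128 / ε) ^ R * t ^ R * rhoWalkG n m A) := by
          ring
      _ ≤ (K * (sumBall X k).card) * ((128 / ε) ^ R * t ^ R * rhoWalkG n m A) := by gcongr
      _ = K * (128 / ε) ^ R * t ^ R * ((sumBall X k).card * rhoWalkG n m A) := by ring
      _ ≤ K * (128 / ε) ^ R * t ^ R * (64 * (3 / 4) ^ i) := by gcongr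
      _ = K * 64 * (128 / ε) ^ R * (t ^ R * (3 / 4) ^ i) := by ring
      _ ≤ K * 64 * (128 / ε) ^ R * M := by
          gcongr
          exact hMbound i
      _ = _ := by ring
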